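/- arXiv:2403.02764 — 4 statements merged into one kernel-verified Lean document; each statement's English description precedes it below -/
import Mathlib

section
/- Let Ω ⊂ ℝ^d be compact and convex with non-empty interior, V a real finite-dimensional inner product space, and λ > 0. The functional T^λ_{1,1}(μ,ν) = min{ ∫_Ω |σ|_{V^d} + λ ∫_Ω |δ|_V : σ ∈ M(Ω;V^d), δ ∈ M(Ω;V), div(σ) = μ − ν + δ } defines a distance on M(Ω;V): it is non-negative, symmetric, vanishes exactly when μ = ν, and satisfies the triangle inequality. -/
open MeasureTheory Set Filter
open scoped ENNReal RealInnerProductSpace Topology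

noncomputable section

/-- Euclidean space `ℝ^d`. -/
abbrev Euc (d : ℕ) := EuclideanSpace ℝ (Fin d)

variable {d : ℕ} {V : Type*} [NormedAddCommGroup V] [InnerProductSpace ℝ V]
  [FiniteDimensional ℝ V]

/-- Frobenius inner product on `V^d ≅ L(ℝ^d; V)`: `⟨A,B⟩ = Tr(Aᵀ B)`. -/
def frobInner (A B : Euc d →L[ℝ] V) : ℝ :=
  ∑ i, ⟪A (EuclideanSpace.single i 1), B (EuclideanSpace.single i 1)⟫

/-- Frobenius norm on `V^d ≅ L(ℝ^d; V)`. -/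
def frobNorm (A : Euc d →L[ℝ] V) : ℝ :=
  Real.sqrt (∑ i, ‖A (EuclideanSpace.single i 1)‖ ^ 2)

/-- Componentwise divergence of a (smooth) map `ψ : ℝ^d → V^d`. -/
def divg (ψ : Euc d → Euc d →L[ℝ] V) (x : Euc d) : V :=
  ∑ i, fderiv ℝ ψ x (EuclideanSpace.single i 1) (EuclideanSpace.single i 1)

/-- Test functions: smooth, compactly supported in the interior of `Ω`. -/
def IsTest (Ω : Set (Euc d)) (ψ : Euc d → Euc d →L[ℝ] V) : Prop :=
  ContDiff ℝ (⊤ : ℕ∞) ψ ∧ HasCompactSupport ψ ∧ tsupport ψ ⊆ interior Ω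

/-- `g` is the (componentwise) distributional gradient of `φ` on `Ω`:
for every test function `ψ`, `∫_Ω ⟨φ, div ψ⟩ = -∫_Ω ⟨g, ψ⟩_{V^d}`. -/
def IsDistribGrad (Ω : Set (Euc d)) (φ : Euc d → V)
    (g : Euc d → Euc d →L[ℝ] V) : Prop :=
  ∀ ψ : Euc d → Euc d →L[ℝ] V, IsTest Ω ψ →
    ∫ x in Ω, ⟪φ x, divg ψ x⟫ = - ∫ x in Ω, frobInner (g x) (ψ x)

/-- `φ ∈ C(Ω;V)` and its distributional gradient admits an `L^∞` representative
whose Frobenius norm is at most `c` almost everywhere on `Ω`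
(i.e. `|∇φ|_{V^d,∞} ≤ c`). -/
def FrLipOn (c : ℝ) (Ω : Set (Euc d)) (φ : Euc d → V) : Prop :=
  ContinuousOn φ Ω ∧ ∃ g : Euc d → Euc d →L[ℝ] V,
    AEStronglyMeasurable g (volume.restrict Ω) ∧
    (∀ᵐ x ∂(volume.restrict Ω), frobNorm (g x) ≤ c) ∧
    IsDistribGrad Ω φ g

/-- A finite `W`-valued measure on `Ω`, represented (by polar decomposition /
Radon–Nikodym) as a density `den` integrable against a positive measure `ρ`
concentrated on `Ω`. -/
structure VMeas (Ω : Set (Euc d)) (W : Type*) [NormedAddCommGroup W] where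
  ρ : Measure (Euc d)
  den : Euc d → W
  null_compl : ρ Ωᶜ = 0
  integrable : Integrable den ρ

namespace VMeas

variable {Ω : Set (Euc d)}

/-- Duality pairing `∫_Ω ⟨φ, μ⟩_V` of `μ ∈ M(Ω;V)` with `φ : Ω → V`. -/
def pair (μ : VMeas Ω V) (φ : Euc d → V) : ℝ :=
  ∫ x, ⟪φ x, μ.den x⟫ ∂μ.ρ

/-- Total variation norm `∫_Ω |μ|_V` of `μ ∈ M(Ω;V)`. -/
def tv (μ : VMeas Ω V) : ℝ := ∫ x, ‖μ.den x‖ ∂μ.ρ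

/-- Total mass `∫_Ω μ ∈ V` of `μ ∈ M(Ω;V)`. -/
def mass (μ : VMeas Ω V) : V := ∫ x, μ.den x ∂μ.ρ

/-- Frobenius duality pairing `∫_Ω ⟨ψ, σ⟩_{V^d}` of `σ ∈ M(Ω;V^d)` with
`ψ : Ω → V^d`. -/
def fpair (σ : VMeas Ω (Euc d →L[ℝ] V)) (ψ : Euc d → Euc d →L[ℝ] V) : ℝ :=
  ∫ x, frobInner (ψ x) (σ.den x) ∂σ.ρ

/-- Total variation norm `∫_Ω |σ|_{V^d}` of `σ ∈ M(Ω;V^d)` w.r.t. the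
Frobenius norm on `V^d`. -/
def ftv (σ : VMeas Ω (Euc d →L[ℝ] V)) : ℝ := ∫ x, frobNorm (σ.den x) ∂σ.ρ

end VMeas

/-- The divergence constraint `div σ = D` (with zero-flux boundary conditions),
in the weak sense: `-∫_Ω ⟨∇φ, σ⟩_{V^d} = D(φ)` for every `φ ∈ C¹(Ω;V)`.
Here `D` is the pairing functional of the prescribed right-hand side. -/
def DivEq {Ω : Set (Euc d)} (σ : VMeas Ω (Euc d →L[ℝ] V))
    (D : (Euc d → V) → ℝ) : Prop :=
  ∀ φ : Euc d → V, ContDiff ℝ 1 φ → -(σ.fpair fun x => fderiv ℝ φ x) = D φ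

/-- The (possibly infinite) value `sup { D(φ) : |∇φ|_{V^d,∞} ≤ 1 }`, used to
define `W₁^V` through the pairing functional `D` of `ν - μ`. -/
def W1fn (Ω : Set (Euc d)) (D : (Euc d → V) → ℝ) : ℝ≥0∞ :=
  ⨆ φ ∈ {φ : Euc d → V | FrLipOn 1 Ω φ}, ENNReal.ofReal (D φ)

/-- The unbalanced transport cost in Beckmann form:
`T^λ_{1,1}(μ,ν) = min { ∫_Ω |σ|_{V^d} + λ ∫_Ω |δ|_V : div σ = μ - ν + δ }`. -/
def T11 {Ω : Set (Euc d)} (lam : ℝ) (μ ν : VMeas Ω V) : ℝ≥0∞ :=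
  ⨅ p ∈ {p : VMeas Ω (Euc d →L[ℝ] V) × VMeas Ω V |
      DivEq p.1 fun φ => μ.pair φ - ν.pair φ + p.2.pair φ},
    ENNReal.ofReal (p.1.ftv + lam * p.2.tv)

section helpers

def frobJ : (Euc d →L[ℝ] V) →L[ℝ] PiLp 2 (fun _ : Fin d => V) :=
  ((PiLp.continuousLinearEquiv 2 ℝ (fun _ : Fin d => V)).symm :
    (Fin d → V) →L[ℝ] PiLp 2 (fun _ : Fin d => V)).comp
    (ContinuousLinearMap.pi fun i =>
      ContinuousLinearMap.apply ℝ V (EuclideanSpace.single i (1 : ℝ)))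

theorem frobJ_apply (A : Euc d →L[ℝ] V) (i : Fin d) :
    frobJ A i = A (EuclideanSpace.single i 1) := by
  simp [frobJ]

theorem frobInner_eq (A B : Euc d →L[ℝ] V) : frobInner A B = ⟪frobJ A, frobJ B⟫ := by
  simp [frobInner, PiLp.inner_apply, frobJ_apply]

theorem frobNorm_eq (A : Euc d →L[ℝ] V) : frobNorm A = ‖frobJ A‖ := by
  simp [frobNorm, PiLp.norm_eq_of_L2, frobJ_apply]

attribute [irreducible] frobJ

theorem exists_bound {W : Type*} [NormedAddCommGroup W] {Ω : Set (Euc d)}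
    (hΩ : IsCompact Ω) {φ : Euc d → W} (hφ : Continuous φ) :
    ∃ C : ℝ, 0 ≤ C ∧ ∀ x ∈ Ω, ‖φ x‖ ≤ C := by
  obtain ⟨C, hC⟩ := hΩ.exists_bound_of_continuousOn hφ.continuousOn
  exact ⟨max C 0, le_max_right _ _, fun x hx => (hC x hx).trans (le_max_left _ _)⟩

theorem pairing_le {W : Type*} [NormedAddCommGroup W] [InnerProductSpace ℝ W]
    {Ω : Set (Euc d)} {ρ : Measure (Euc d)}
    (hρ : ρ Ωᶜ = 0) {φ g : Euc d → W} (hg : Integrable g ρ)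
    {C : ℝ} (hC : ∀ x ∈ Ω, ‖φ x‖ ≤ C) :
    |∫ x, ⟪φ x, g x⟫ ∂ρ| ≤ C * ∫ x, ‖g x‖ ∂ρ := by
  rw [← integral_const_mul, ← Real.norm_eq_abs]
  refine norm_integral_le_of_norm_le (hg.norm.const_mul C) ?_
  have : ∀ᵐ x ∂ρ, x ∈ Ω := by rw [ae_iff]; exact hρ
  filter_upwards [this] with x hx
  exact (norm_inner_le_norm _ _).trans
    (mul_le_mul_of_nonneg_right (hC x hx) (norm_nonneg _))

theorem pairing_int {W : Type*} [NormedAddCommGroup W] [InnerProductSpace ℝ W]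
    {Ω : Set (Euc d)} (hΩ : IsCompact Ω) {ρ : Measure (Euc d)}
    (hρ : ρ Ωᶜ = 0) {φ g : Euc d → W} (hg : Integrable g ρ) (hφ : Continuous φ) :
    Integrable (fun x => ⟪φ x, g x⟫) ρ := by
  obtain ⟨C, -, hC⟩ := exists_bound hΩ hφ
  refine (hg.norm.const_mul C).mono' (hφ.aestronglyMeasurable.inner hg.1) ?_
  have : ∀ᵐ x ∂ρ, x ∈ Ω := by rw [ae_iff]; exact hρ
  filter_upwards [this] with x hx
  exact (norm_inner_le_norm _ _).trans
    (mul_le_mul_of_nonneg_right (hC x hx) (norm_nonneg _))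

/-- The finite measure `|σ|`. -/
def varm {W : Type*} [NormedAddCommGroup W] {Ω : Set (Euc d)} (σ : VMeas Ω W) :
    Measure (Euc d) := σ.ρ.withDensity fun x => (‖σ.den x‖₊ : ℝ≥0∞)

theorem varm_finite {W : Type*} [NormedAddCommGroup W] {Ω : Set (Euc d)} (σ : VMeas Ω W) :
    IsFiniteMeasure (varm σ) :=
  isFiniteMeasure_withDensity (ne_of_lt σ.integrable.2)

theorem varm_null {W : Type*} [NormedAddCommGroup W] {Ω : Set (Euc d)} (σ : VMeas Ω W) :
    varm σ Ωᶜ = 0 :=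
  withDensity_absolutelyContinuous _ _ σ.null_compl

theorem transfer {W : Type*} [NormedAddCommGroup W] [NormedSpace ℝ W] {Ω : Set (Euc d)}
    (σ : VMeas Ω W) (m : Measure (Euc d)) [IsFiniteMeasure m] (hm : varm σ ≪ m) :
    ∃ g : Euc d → W, Integrable g m ∧ ∀ F : Euc d → W → ℝ,
      (∀ x (c : ℝ) w, 0 ≤ c → F x (c • w) = c * F x w) →
      ∫ x, F x (g x) ∂m = ∫ x, F x (σ.den x) ∂σ.ρ := by
  have := varm_finite σ
  have hmeas := σ.integrable.1
  have hLD : (varm σ).HaveLebesgueDecomposition m :=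
    Measure.haveLebesgueDecomposition_of_sigmaFinite _ _
  refine ⟨fun x => ((varm σ).rnDeriv m x).toReal • (‖σ.den x‖⁻¹ • σ.den x), ?_, ?_⟩
  · rw [integrable_rnDeriv_smul_iff hm]
    refine Integrable.of_bound (C := 1) ?_ ?_
    · refine AEStronglyMeasurable.mono_ac (withDensity_absolutelyContinuous _ _) ?_
      exact (hmeas.norm.aemeasurable.inv.aestronglyMeasurable).smul hmeas
    · refine Eventually.of_forall fun x => ?_
      rw [norm_smul, norm_inv, norm_norm]
      exact inv_mul_le_one
  · intro F hF
    have h1 : ∀ x, F x (((varm σ).rnDeriv m x).toReal • (‖σ.den x‖⁻¹ • σ.den x))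
        = ((varm σ).rnDeriv m x).toReal • F x (‖σ.den x‖⁻¹ • σ.den x) := fun x => by
      rw [hF _ _ _ ENNReal.toReal_nonneg, smul_eq_mul]
    simp_rw [h1]
    rw [integral_rnDeriv_smul hm, varm,
      integral_withDensity_eq_integral_smul₀ hmeas.nnnorm.aemeasurable]
    congr 1
    ext x
    rw [NNReal.smul_def, coe_nnnorm, smul_eq_mul, ← hF _ _ _ (norm_nonneg _), smul_smul]
    by_cases h : σ.den x = 0
    · simp [h]
    · rw [mul_inv_cancel₀ (norm_ne_zero_iff.2 h), one_smul]

theorem exists_sum {W : Type*} [NormedAddCommGroup W] [NormedSpace ℝ W]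
    {Ω : Set (Euc d)} (s t : VMeas Ω W) :
    ∃ (m : Measure (Euc d)) (g h : Euc d → W), m Ωᶜ = 0 ∧ Integrable g m ∧ Integrable h m ∧
      ∀ F : Euc d → W → ℝ, (∀ x (c : ℝ) w, 0 ≤ c → F x (c • w) = c * F x w) →
      ∫ x, F x (g x) ∂m = ∫ x, F x (s.den x) ∂s.ρ ∧
      ∫ x, F x (h x) ∂m = ∫ x, F x (t.den x) ∂t.ρ := by
  have := varm_finite s
  have := varm_finite t
  obtain ⟨g, hg, hg'⟩ := transfer s (varm s + varm t)
    (Measure.absolutelyContinuous_of_le (Measure.le_add_right le_rfl))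
  obtain ⟨h, hh, hh'⟩ := transfer t (varm s + varm t)
    (Measure.absolutelyContinuous_of_le (Measure.le_add_left le_rfl))
  exact ⟨varm s + varm t, g, h, by simp [varm_null], hg, hh, fun F hF => ⟨hg' F hF, hh' F hF⟩⟩

theorem sum_V {Ω : Set (Euc d)} (hΩ : IsCompact Ω) (s t : VMeas Ω V) :
    ∃ r : VMeas Ω V, r.tv ≤ s.tv + t.tv ∧
      ∀ φ : Euc d → V, Continuous φ → r.pair φ = s.pair φ + t.pair φ := by
  obtain ⟨m, g, h, hm, hg, hh, H⟩ := exists_sum s t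
  refine ⟨⟨m, g + h, hm, hg.add hh⟩, ?_, ?_⟩
  · obtain ⟨h1, h2⟩ := H (fun _ w => ‖w‖) (fun x c w hc => by
      rw [norm_smul, Real.norm_of_nonneg hc])
    simp only [VMeas.tv]
    rw [← h1, ← h2, ← integral_add hg.norm hh.norm]
    exact integral_mono (hg.add hh).norm (hg.norm.add hh.norm) fun x => norm_add_le _ _
  · intro φ hφ
    obtain ⟨h1, h2⟩ := H (fun x w => ⟪φ x, w⟫) (fun x c w hc => by rw [real_inner_smul_right])
    simp only [VMeas.pair]
    rw [← h1, ← h2, ← integral_add (pairing_int hΩ hm hg hφ) (pairing_int hΩ hm hh hφ)]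
    simp [inner_add_right]

theorem sum_F {Ω : Set (Euc d)} (hΩ : IsCompact Ω) (s t : VMeas Ω (Euc d →L[ℝ] V)) :
    ∃ r : VMeas Ω (Euc d →L[ℝ] V), r.ftv ≤ s.ftv + t.ftv ∧
      ∀ φ : Euc d → (Euc d →L[ℝ] V), Continuous φ → r.fpair φ = s.fpair φ + t.fpair φ := by
  obtain ⟨m, g, h, hm, hg, hh, H⟩ := exists_sum s t
  have hJg : Integrable (fun x => frobJ (g x)) m := frobJ.integrable_comp hg
  have hJh : Integrable (fun x => frobJ (h x)) m := frobJ.integrable_comp hh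
  refine ⟨⟨m, g + h, hm, hg.add hh⟩, ?_, ?_⟩
  · obtain ⟨h1, h2⟩ := H (fun _ w => ‖frobJ w‖) (fun x c w hc => by
      rw [map_smul, norm_smul, Real.norm_of_nonneg hc])
    simp only [VMeas.ftv, frobNorm_eq]
    rw [← h1, ← h2, ← integral_add hJg.norm hJh.norm]
    refine integral_mono (frobJ.integrable_comp (hg.add hh)).norm
      (hJg.norm.add hJh.norm) fun x => ?_
    simpa using norm_add_le (frobJ (g x)) (frobJ (h x))
  · intro φ hφ
    obtain ⟨h1, h2⟩ := H (fun x w => ⟪frobJ (φ x), frobJ w⟫)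
      (fun x c w hc => by rw [map_smul, real_inner_smul_right])
    have hJφ : Continuous fun x => frobJ (φ x) := frobJ.continuous.comp hφ
    simp only [VMeas.fpair, frobInner_eq]
    rw [← h1, ← h2, ← integral_add (pairing_int hΩ hm hJg hJφ) (pairing_int hΩ hm hJh hJφ)]
    simp [inner_add_right]

theorem tv_nonneg' {Ω : Set (Euc d)} (s : VMeas Ω V) : 0 ≤ s.tv :=
  integral_nonneg fun _ => norm_nonneg _

theorem ftv_nonneg' {Ω : Set (Euc d)} (s : VMeas Ω (Euc d →L[ℝ] V)) : 0 ≤ s.ftv :=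
  integral_nonneg fun _ => Real.sqrt_nonneg _

theorem T11_symm_le {Ω : Set (Euc d)} (lam : ℝ) (μ ν : VMeas Ω V) :
    T11 lam μ ν ≤ T11 lam ν μ := by
  unfold T11
  refine le_iInf₂ fun p hp => ?_
  refine iInf₂_le_of_le (⟨⟨p.1.ρ, -p.1.den, p.1.null_compl, p.1.integrable.neg⟩,
    ⟨p.2.ρ, -p.2.den, p.2.null_compl, p.2.integrable.neg⟩⟩) ?_ (le_of_eq ?_)
  · intro φ hφ
    have := hp φ hφ
    simp only [VMeas.fpair, VMeas.pair, frobInner_eq, Pi.neg_apply, map_neg, inner_neg_right,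
      integral_neg] at this ⊢
    linarith
  · simp [VMeas.ftv, VMeas.tv, frobNorm_eq]

theorem T11_tri {Ω : Set (Euc d)} (hΩ : IsCompact Ω) (lam : ℝ) (hlam : 0 < lam)
    (μ ν ξ : VMeas Ω V) :
    T11 lam μ ξ ≤ T11 lam μ ν + T11 lam ν ξ := by
  unfold T11
  refine ENNReal.le_iInf₂_add_iInf₂ fun p hp q hq => ?_
  obtain ⟨σ, hσ, hσ'⟩ := sum_F hΩ p.1 q.1
  obtain ⟨δ, hδ, hδ'⟩ := sum_V hΩ p.2 q.2
  have hp0 := add_nonneg (ftv_nonneg' p.1) (mul_nonneg hlam.le (tv_nonneg' p.2))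
  have hq0 := add_nonneg (ftv_nonneg' q.1) (mul_nonneg hlam.le (tv_nonneg' q.2))
  refine iInf₂_le_of_le (σ, δ) ?_ ?_
  · intro φ hφ
    have h1 := hp φ hφ
    have h2 := hq φ hφ
    have h3 := hσ' (fun x => fderiv ℝ φ x) (hφ.continuous_fderiv one_ne_zero)
    have h4 := hδ' φ hφ.continuous
    simp only at h1 h2 ⊢
    linarith
  · rw [← ENNReal.ofReal_add hp0 hq0]
    refine ENNReal.ofReal_le_ofReal ?_
    have := mul_le_mul_of_nonneg_left hδ hlam.le
    simp only
    linarith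

theorem T11_zero_C1 {Ω : Set (Euc d)} (hΩ : IsCompact Ω) (lam : ℝ) (hlam : 0 < lam)
    (μ ν : VMeas Ω V) (h0 : T11 lam μ ν = 0) (φ : Euc d → V) (hφ : ContDiff ℝ 1 φ) :
    μ.pair φ = ν.pair φ := by
  have hdc : Continuous fun x => frobJ (fderiv ℝ φ x) :=
    frobJ.continuous.comp (hφ.continuous_fderiv one_ne_zero)
  obtain ⟨C, hC0, hC⟩ := exists_bound hΩ hφ.continuous
  obtain ⟨D, hD0, hD⟩ := exists_bound hΩ hdc
  have key : ∀ ε : ℝ, 0 < ε → |μ.pair φ - ν.pair φ| ≤ (D + C / lam) * ε := by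
    intro ε hε
    have hlt : T11 lam μ ν < ENNReal.ofReal ε := by rw [h0]; simpa using hε
    unfold T11 at hlt
    simp only [iInf_lt_iff] at hlt
    obtain ⟨p, hp, hlt⟩ := hlt
    have hlt := (ENNReal.ofReal_lt_ofReal_iff hε).1 hlt
    have h1 := hp φ hφ
    have ha := ftv_nonneg' p.1
    have hb := tv_nonneg' p.2
    have h2 : |p.1.fpair fun x => fderiv ℝ φ x| ≤ D * p.1.ftv := by
      simp only [VMeas.fpair, VMeas.ftv, frobInner_eq, frobNorm_eq]
      exact pairing_le (φ := fun x => frobJ (fderiv ℝ φ x))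
        (g := fun x => frobJ (p.1.den x)) p.1.null_compl (frobJ.integrable_comp p.1.integrable) hD
    have h3 : |p.2.pair φ| ≤ C * p.2.tv := pairing_le p.2.null_compl p.2.integrable hC
    have h4 : μ.pair φ - ν.pair φ = -(p.1.fpair fun x => fderiv ℝ φ x) - p.2.pair φ := by
      simp only at h1; linarith
    have h5 : p.1.ftv ≤ ε := by nlinarith
    have h6 : p.2.tv ≤ ε / lam := by rw [le_div_iff₀ hlam]; nlinarith
    calc |μ.pair φ - ν.pair φ| ≤ D * p.1.ftv + C * p.2.tv := by
          rw [h4]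
          refine (abs_sub _ _).trans ?_
          rw [abs_neg]
          exact add_le_add h2 h3
      _ ≤ D * ε + C * (ε / lam) := by gcongr
      _ = _ := by ring
  have hE : 0 ≤ D + C / lam := by positivity
  have : |μ.pair φ - ν.pair φ| ≤ 0 := by
    refine le_of_forall_pos_le_add fun ε hε => ?_
    refine (key (ε / (D + C / lam + 1)) (by positivity)).trans ?_
    rw [mul_div_assoc', div_le_iff₀ (by positivity)]
    nlinarith
  exact sub_eq_zero.1 (abs_nonpos_iff.1 this)

theorem pair_sub_le {Ω : Set (Euc d)} (hΩ : IsCompact Ω) (μ : VMeas Ω V)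
    {φ ψ : Euc d → V} (hφ : Continuous φ) (hψ : Continuous ψ) {ε : ℝ}
    (h : ∀ x, ‖φ x - ψ x‖ ≤ ε) : |μ.pair φ - μ.pair ψ| ≤ ε * μ.tv := by
  unfold VMeas.pair
  rw [← integral_sub (pairing_int hΩ μ.null_compl μ.integrable hφ)
    (pairing_int hΩ μ.null_compl μ.integrable hψ)]
  simp_rw [← inner_sub_left]
  exact pairing_le μ.null_compl μ.integrable fun x _ => h x

theorem T11_zero_cont {Ω : Set (Euc d)} (hΩ : IsCompact Ω) (lam : ℝ) (hlam : 0 < lam)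
    (μ ν : VMeas Ω V) (h0 : T11 lam μ ν = 0) (φ : Euc d → V) (hφ : Continuous φ) :
    μ.pair φ = ν.pair φ := by
  have key : ∀ ε : ℝ, 0 < ε → |μ.pair φ - ν.pair φ| ≤ ε * (μ.tv + ν.tv) := by
    intro ε hε
    obtain ⟨g, hg, hd, -⟩ := hφ.exists_contDiff_approx 1 (ε := fun _ => ε)
      continuous_const (fun _ => hε)
    have hg1 : ContDiff ℝ 1 g := by exact_mod_cast hg
    have hle : ∀ x, ‖φ x - g x‖ ≤ ε := fun x => by
      rw [← dist_eq_norm, dist_comm]; exact (hd x).le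
    have h1 := pair_sub_le hΩ μ hφ hg1.continuous hle
    have h2 := pair_sub_le hΩ ν hφ hg1.continuous hle
    have h3 := T11_zero_C1 hΩ lam hlam μ ν h0 g hg1
    rw [abs_le] at *
    constructor <;> linarith
  have ha := tv_nonneg' μ
  have hb := tv_nonneg' ν
  have : |μ.pair φ - ν.pair φ| ≤ 0 := by
    refine le_of_forall_pos_le_add fun ε hε => ?_
    refine (key (ε / (μ.tv + ν.tv + 1)) (by positivity)).trans ?_
    rw [div_mul_eq_mul_div, div_le_iff₀ (by positivity)]
    nlinarith
  exact sub_eq_zero.1 (abs_nonpos_iff.1 this)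

theorem pair_congr {Ω : Set (Euc d)} (μ : VMeas Ω V) {φ ψ : Euc d → V}
    (h : ∀ x ∈ Ω, φ x = ψ x) : μ.pair φ = μ.pair ψ := by
  refine integral_congr_ae ?_
  have : ∀ᵐ x ∂μ.ρ, x ∈ Ω := by rw [ae_iff]; exact μ.null_compl
  filter_upwards [this] with x hx
  rw [h x hx]

theorem T11_zero_contOn {Ω : Set (Euc d)} (hΩ : IsCompact Ω) (lam : ℝ) (hlam : 0 < lam)
    (μ ν : VMeas Ω V) (h0 : T11 lam μ ν = 0) (φ : Euc d → V) (hφ : ContinuousOn φ Ω) :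
    μ.pair φ = ν.pair φ := by
  have : TietzeExtension V := TietzeExtension.of_tvs ℝ
  obtain ⟨g, hg⟩ := ContinuousMap.exists_restrict_eq hΩ.isClosed
    (⟨Ω.domRestrict φ, hφ.domRestrict⟩ : C(Ω, V))
  have hEq : ∀ x ∈ Ω, φ x = g x := fun x hx => by
    have := DFunLike.congr_fun hg ⟨x, hx⟩
    exact this.symm
  rw [pair_congr μ hEq, pair_congr ν hEq]
  exact T11_zero_cont hΩ lam hlam μ ν h0 g g.continuous

theorem T11_eq_zero {Ω : Set (Euc d)} (lam : ℝ) (μ ν : VMeas Ω V)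
    (h : ∀ φ : Euc d → V, ContinuousOn φ Ω → μ.pair φ = ν.pair φ) : T11 lam μ ν = 0 := by
  refine le_antisymm ?_ zero_le
  unfold T11
  refine iInf₂_le_of_le (⟨⟨0, 0, by simp, integrable_zero_measure⟩,
    ⟨0, 0, by simp, integrable_zero_measure⟩⟩) ?_ (le_of_eq ?_)
  · intro φ hφ
    have := h φ hφ.continuous.continuousOn
    simp only [VMeas.fpair, VMeas.pair, integral_zero_measure] at this ⊢
    linarith
  · simp [VMeas.ftv, VMeas.tv]

end helpers

/-- `T^λ_{1,1}` is a distance on `M(Ω;V)`: non-negative,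
vanishing exactly when `μ = ν` (i.e. when the two measures have equal pairings
against all continuous functions), symmetric, and satisfying the triangle
inequality. -/
theorem T11_is_distance
    (Ω : Set (Euc d)) (hΩcomp : IsCompact Ω) (hΩconv : Convex ℝ Ω)
    (hΩint : (interior Ω).Nonempty)
    (lam : ℝ) (hlam : 0 < lam) (μ ν ξ : VMeas Ω V) :
    0 ≤ T11 lam μ ν ∧
    (T11 lam μ ν = 0 ↔
      ∀ φ : Euc d → V, ContinuousOn φ Ω → μ.pair φ = ν.pair φ) ∧
    T11 lam μ ν = T11 lam ν μ ∧
    T11 lam μ ξ ≤ T11 lam μ ν + T11 lam ν ξ := by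
  exact ⟨zero_le, ⟨fun h φ hφ => T11_zero_contOn hΩcomp lam hlam μ ν h φ hφ,
    fun h => T11_eq_zero lam μ ν h⟩,
    le_antisymm (T11_symm_le lam μ ν) (T11_symm_le lam ν μ),
    T11_tri hΩcomp lam hlam μ ν ξ⟩
end
end

section
/- Let Ω ⊂ ℝ^d be compact and convex with non-empty interior, V a real finite-dimensional inner product space, λ > 0, and let μ = M₁ δ_{x₁}, ν = M₂ δ_{x₂} for M₁, M₂ ∈ V and distinct x₁, x₂ ∈ Ω. Then the vector Kantorovich–Rubinstein value sup{ ∫_Ω ⟨φ, ν−μ⟩_V : φ ∈ C(Ω;V), |∇φ|_{V^d,∞} ≤ 1, |φ|_{V,∞} ≤ λ } equals |x₁−x₂| · max{ ⟨A, M₁⟩_V − ⟨B, M₂⟩_V : A, B ∈ V, |A|_V ≤ γ, |B|_V ≤ γ, |A−B|_V ≤ 1 }, where γ = λ/|x₁−x₂|. -/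
open MeasureTheory Set Filter
open scoped ENNReal RealInnerProductSpace Topology

noncomputable section

variable {d : ℕ} {V : Type*} [NormedAddCommGroup V] [InnerProductSpace ℝ V]
  [FiniteDimensional ℝ V]

lemma euc_sum (e : Euc d) : ∑ i, (e i) • (EuclideanSpace.single i (1:ℝ) : Euc d) = e := by
  have := (EuclideanSpace.basisFun (Fin d) ℝ).sum_repr e
  simpa using this

lemma frob_apply_le (A : Euc d →L[ℝ] V) (e : Euc d) : ‖A e‖ ≤ frobNorm A * ‖e‖ := by
  conv_lhs => rw [← euc_sum e]
  rw [map_sum]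
  refine (norm_sum_le _ _).trans ?_
  simp only [map_smul, norm_smul]
  refine (Real.sum_mul_le_sqrt_mul_sqrt _ _ _).trans ?_
  rw [frobNorm, EuclideanSpace.norm_eq, mul_comm]

lemma frobInner_rank (A : Euc d →L[ℝ] V) (e : Euc d) (w : V) (r : ℝ) :
    frobInner A (r • (innerSL ℝ e).smulRight w) = r * ⟪A e, w⟫ := by
  conv_rhs => rw [← euc_sum e]
  simp [frobInner, map_sum, sum_inner, inner_smul_left, inner_smul_right, Finset.mul_sum,
    EuclideanSpace.inner_single_right]

lemma divg_rank (ρ : Euc d → ℝ) (hρ : Differentiable ℝ ρ) (x e : Euc d) (w : V) (t : Euc d) :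
    divg (fun t => ρ (x - t) • (innerSL ℝ e).smulRight w) t = -(fderiv ℝ ρ (x - t) e) • w := by
  have h1 : HasFDerivAt (fun t => ρ (x - t)) (-(fderiv ℝ ρ (x - t))) t := by
    have := (hρ (x - t)).hasFDerivAt.comp t ((hasFDerivAt_id t).const_sub x)
    simpa [Function.comp_def] using this
  have h2 := h1.smul_const ((innerSL ℝ e).smulRight w)
  rw [divg, h2.fderiv]
  conv_rhs => rw [← euc_sum e]
  simp [map_sum, Finset.sum_smul, EuclideanSpace.inner_single_right, smul_smul, mul_comm]

lemma deriv_bound {Ω : Set (Euc d)} (hΩ : IsCompact Ω) {φ : Euc d → V}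
    (hφ : ContinuousOn φ Ω) {g : Euc d → Euc d →L[ℝ] V}
    (hg : ∀ᵐ x ∂(volume.restrict Ω), frobNorm (g x) ≤ 1)
    (hD : IsDistribGrad Ω φ g) (ρ : ContDiffBump (0 : Euc d)) (x : Euc d)
    (hx : Metric.closedBall x ρ.rOut ⊆ interior Ω) (w : V) :
    ‖(MeasureTheory.convolution (fderiv ℝ (ρ.normed volume)) (Ω.indicator fun t => ⟪φ t, w⟫)
      ((ContinuousLinearMap.lsmul ℝ ℝ).precompL (Euc d)) volume) x‖ ≤ ‖w‖ := by
  have hρs : ContDiff ℝ (⊤ : ℕ∞) (ρ.normed volume) := ρ.contDiff_normed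
  have hρd : Differentiable ℝ (ρ.normed volume) := hρs.differentiable (by simp)
  have hu : Integrable (Ω.indicator fun t => ⟪φ t, w⟫) volume := by
    rw [integrable_indicator_iff hΩ.measurableSet]
    exact (hφ.inner continuousOn_const).integrableOn_compact hΩ
  refine ContinuousLinearMap.opNorm_le_bound _ (norm_nonneg _) fun e => ?_
  have hcf : HasCompactSupport (fderiv ℝ (ρ.normed (volume : Measure (Euc d)))) :=
    (ρ.hasCompactSupport_normed).fderiv ℝ
  have hint := hcf.convolutionExists_left
    ((ContinuousLinearMap.lsmul ℝ ℝ : ℝ →L[ℝ] ℝ →L[ℝ] ℝ).precompL (Euc d))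
    (hρs.continuous_fderiv (by simp)) hu.locallyIntegrable x
  have hint' := hint.integrable_swap
  rw [convolution_eq_swap, ContinuousLinearMap.integral_apply hint']
  set ψ : Euc d → Euc d →L[ℝ] V := fun t =>
    ρ.normed volume (x - t) • (innerSL ℝ e).smulRight w with hψ
  have hsupp : Function.support ψ ⊆ Metric.closedBall x ρ.rOut := by
    intro t ht
    have : ρ.normed volume (x - t) ≠ 0 := by
      intro h0
      apply ht
      simp [hψ, h0]
    have h3 : x - t ∈ Function.support (ρ.normed (volume : Measure (Euc d))) := this
    rw [ρ.support_normed_eq] at h3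
    rw [Metric.mem_closedBall, dist_comm, dist_eq_norm]
    simpa using (Metric.mem_ball.1 h3).le
  have htsupp : tsupport ψ ⊆ Metric.closedBall x ρ.rOut :=
    closure_minimal hsupp Metric.isClosed_closedBall
  have hT : IsTest Ω ψ := by
    refine ⟨?_, ?_, htsupp.trans hx⟩
    · exact (hρs.comp (contDiff_const.sub contDiff_id)).smul contDiff_const
    · exact HasCompactSupport.of_support_subset_isCompact (isCompact_closedBall x ρ.rOut) hsupp
  have key := hD ψ hT
  have e1 : ∫ t, ((((ContinuousLinearMap.lsmul ℝ ℝ : ℝ →L[ℝ] ℝ →L[ℝ] ℝ).precompL (Euc d))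
      (fderiv ℝ (ρ.normed volume) (x - t))) ((Ω.indicator fun t => ⟪φ t, w⟫) t)) e
      = - ∫ t in Ω, ⟪φ t, divg ψ t⟫ := by
    rw [← integral_indicator hΩ.measurableSet, ← integral_neg]
    congr 1
    ext t
    rw [hψ, ContinuousLinearMap.precompL_apply]
    by_cases ht : t ∈ Ω
    · simp only [indicator_of_mem ht]
      rw [divg_rank _ hρd]
      simp [inner_smul_right]
    · simp [indicator_of_notMem ht]
  rw [e1, key, neg_neg]
  have hi : Integrable (fun t => ρ.normed volume (x - t)) (volume : Measure (Euc d)) :=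
    ρ.integrable_normed.comp_sub_left x
  refine (norm_integral_le_of_norm_le (g := fun t => ρ.normed volume (x - t) * (‖w‖ * ‖e‖))
    (hi.integrableOn.mul_const _) ?_).trans ?_
  · filter_upwards [hg] with t ht
    rw [hψ, frobInner_rank, norm_mul, Real.norm_of_nonneg (ρ.nonneg_normed _)]
    refine mul_le_mul_of_nonneg_left ?_ (ρ.nonneg_normed _)
    refine (norm_inner_le_norm _ _).trans ?_
    rw [mul_comm ‖w‖]
    refine mul_le_mul_of_nonneg_right ((frob_apply_le _ _).trans ?_) (norm_nonneg _)
    exact mul_le_of_le_one_left (norm_nonneg _) ht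
  · rw [integral_mul_const]
    refine mul_le_of_le_one_left (by positivity) ?_
    refine (setIntegral_le_integral hi (.of_forall fun t => ρ.nonneg_normed _)).trans ?_
    rw [integral_sub_left_eq_self (fun t => ρ.normed volume t) volume x, ρ.integral_normed]

lemma lip_interior {Ω : Set (Euc d)} (hΩ : IsCompact Ω) (hconv : Convex ℝ Ω) {φ : Euc d → V}
    (h : FrLipOn 1 Ω φ) {a b : Euc d} (ha : a ∈ interior Ω) (hb : b ∈ interior Ω) :
    ‖φ b - φ a‖ ≤ ‖b - a‖ := by
  obtain ⟨hφ, g, -, hg, hD⟩ := h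
  set w := φ b - φ a with hw
  have hseg : segment ℝ a b ⊆ interior Ω := hconv.interior.segment_subset ha hb
  have hsc : IsCompact (segment ℝ a b) := by
    rw [segment_eq_image_lineMap]
    exact isCompact_Icc.image (AffineMap.lineMap_continuous)
  obtain ⟨δ, hδ, hδs⟩ := hsc.exists_cthickening_subset_open isOpen_interior hseg
  set u := Ω.indicator fun t => ⟪φ t, w⟫ with hu_def
  have hu : Integrable u volume := by
    rw [hu_def, integrable_indicator_iff hΩ.measurableSet]
    exact (hφ.inner continuousOn_const).integrableOn_compact hΩ
  let ρ : ℕ → ContDiffBump (0 : Euc d) := fun n =>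
    ⟨δ / (n + 2), δ / (n + 1), by positivity, by gcongr; norm_num⟩
  have hρ0 : Tendsto (fun n => (ρ n).rOut) atTop (𝓝 0) := by
    have := tendsto_one_div_add_atTop_nhds_zero_nat (𝕜 := ℝ) |>.const_mul δ
    simpa [ρ, div_eq_mul_inv] using this
  have hρδ : ∀ n, (ρ n).rOut ≤ δ := fun n => by
    refine div_le_self hδ.le ?_
    have : (0:ℝ) ≤ n := n.cast_nonneg
    linarith
  have hlim : ∀ y ∈ interior Ω, Tendsto (fun n => MeasureTheory.convolution
      ((ρ n).normed volume) u (ContinuousLinearMap.lsmul ℝ ℝ) volume y) atTop (𝓝 ⟪φ y, w⟫) := by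
    intro y hy
    refine ContDiffBump.convolution_tendsto_right (g := fun _ => u) (k := fun _ => y) hρ0
      (.of_forall fun _ => hu.aestronglyMeasurable) ?_ tendsto_const_nhds
    have hn : Ω ∈ 𝓝 y := mem_interior_iff_mem_nhds.1 hy
    have hc : ContinuousAt (fun t => ⟪φ t, w⟫) y :=
      (hφ.inner continuousOn_const).continuousAt hn
    have hc' : Tendsto u (𝓝 y) (𝓝 ⟪φ y, w⟫) := by
      refine hc.tendsto.congr' ?_
      filter_upwards [hn] with t ht
      simp [hu_def, ht]
    exact hc'.comp tendsto_snd
  have hb1 : ∀ n, ‖MeasureTheory.convolution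
      ((ρ n).normed volume) u (ContinuousLinearMap.lsmul ℝ ℝ) volume b -
      MeasureTheory.convolution
      ((ρ n).normed volume) u (ContinuousLinearMap.lsmul ℝ ℝ) volume a‖ ≤ ‖w‖ * ‖b - a‖ := by
    intro n
    refine Convex.norm_image_sub_le_of_norm_hasFDerivWithin_le (𝕜 := ℝ) (s := segment ℝ a b)
      (fun y _ => (HasCompactSupport.hasFDerivAt_convolution_left _
        (ρ n).hasCompactSupport_normed ((ρ n).contDiff_normed (n := 1)) hu.locallyIntegrable
        y).hasFDerivWithinAt) ?_ (convex_segment a b) (left_mem_segment ℝ a b)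
        (right_mem_segment ℝ a b)
    intro y hy
    refine deriv_bound hΩ hφ hg hD (ρ n) y ?_ w
    refine ((Metric.closedBall_subset_closedBall (hρδ n)).trans ?_).trans hδs
    exact Metric.closedBall_subset_cthickening hy δ
  have hfin := le_of_tendsto ((hlim b hb).sub (hlim a ha)).norm (.of_forall hb1)
  rw [← inner_sub_left, ← hw, real_inner_self_eq_norm_sq, Real.norm_of_nonneg (sq_nonneg _),
    sq] at hfin
  rcases eq_or_lt_of_le (norm_nonneg w) with h0 | h0
  · rw [← h0]; positivity
  · exact le_of_mul_le_mul_left hfin h0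

lemma lip_all {Ω : Set (Euc d)} (hΩ : IsCompact Ω) (hconv : Convex ℝ Ω)
    (hint : (interior Ω).Nonempty) {φ : Euc d → V}
    (h : FrLipOn 1 Ω φ) {a b : Euc d} (ha : a ∈ Ω) (hb : b ∈ Ω) :
    ‖φ b - φ a‖ ≤ ‖b - a‖ := by
  have hcl : closure (interior Ω) = Ω := by
    rw [hconv.closure_interior_eq_closure_of_nonempty_interior hint, hΩ.isClosed.closure_eq]
  obtain ⟨s, hs, hsa⟩ := mem_closure_iff_seq_limit.1 (hcl.symm ▸ ha)
  obtain ⟨t, ht, htb⟩ := mem_closure_iff_seq_limit.1 (hcl.symm ▸ hb)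
  have h1 : ∀ (s : ℕ → Euc d) (a), a ∈ Ω → (∀ n, s n ∈ interior Ω) → Tendsto s atTop (𝓝 a) →
      Tendsto (fun n => φ (s n)) atTop (𝓝 (φ a)) := fun s a ha hs hsa =>
    (h.1 a ha).tendsto.comp (tendsto_nhdsWithin_iff.2
      ⟨hsa, .of_forall fun n => interior_subset (hs n)⟩)
  exact le_of_tendsto_of_tendsto ((h1 t b hb ht htb).sub (h1 s a ha hs hsa)).norm
    (htb.sub hsa).norm (.of_forall fun n => lip_interior hΩ hconv h (hs n) (ht n))

lemma ibp_comp (ψ : Euc d → Euc d →L[ℝ] V) (hψ : ContDiff ℝ (⊤ : ℕ∞) ψ)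
    (hc : HasCompactSupport ψ) (W : V) (f : Euc d → ℝ) (hf : LipschitzWith 1 f) (e : Euc d) :
    (∫ x, fderiv ℝ f x e * ⟪W, ψ x e⟫ = - ∫ x, f x * ⟪W, fderiv ℝ ψ x e e⟫) ∧
    Integrable (fun x => fderiv ℝ f x e * ⟪W, ψ x e⟫) ∧
    Integrable (fun x => f x * ⟪W, fderiv ℝ ψ x e e⟫) := by
  have hψe : ContDiff ℝ 1 (fun x => ⟪W, ψ x e⟫) :=
    contDiff_const.inner ℝ ((hψ.of_le (by exact_mod_cast le_top)).clm_apply contDiff_const)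
  have hce : HasCompactSupport (fun x => ⟪W, ψ x e⟫) := by
    refine hc.mono fun x hx h0 => hx ?_
    simp [h0]
  obtain ⟨C, hC⟩ := hψe.lipschitzWith_of_hasCompactSupport hce (by simp)
  have hd : ∀ x, lineDeriv ℝ (fun x => ⟪W, ψ x e⟫) x (-e) = - ⟪W, fderiv ℝ ψ x e e⟫ := by
    intro x
    have h1 : HasFDerivAt ψ (fderiv ℝ ψ x) x := (hψ.differentiable (by simp) x).hasFDerivAt
    have h2 : HasFDerivAt (fun x => ⟪W, ψ x e⟫)
        ((innerSL ℝ W).comp ((ContinuousLinearMap.apply ℝ V e).comp (fderiv ℝ ψ x))) x :=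
      (innerSL ℝ W).hasFDerivAt.comp x ((ContinuousLinearMap.apply ℝ V e).hasFDerivAt.comp x h1)
    rw [h2.differentiableAt.lineDeriv_eq_fderiv, h2.fderiv]
    simp
  have hD : ∀ᵐ x, fderiv ℝ f x e * ⟪W, ψ x e⟫ = lineDeriv ℝ f x e * ⟪W, ψ x e⟫ := by
    filter_upwards [hf.ae_differentiableAt (μ := volume)] with x hx
    rw [hx.lineDeriv_eq_fderiv]
  refine ⟨?_, ?_, ?_⟩
  · rw [integral_congr_ae hD, hf.integral_lineDeriv_mul_eq hC hce, ← integral_neg]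
    congr 1
    ext x
    rw [hd]; ring
  · refine (hψe.continuous.integrable_of_hasCompactSupport hce).bdd_mul (c := ‖e‖) ?_ ?_
    · exact (measurable_fderiv_apply_const ℝ f e).aestronglyMeasurable
    · refine .of_forall fun x => ?_
      refine ((fderiv ℝ f x).le_opNorm e).trans ?_
      refine mul_le_of_le_one_left (norm_nonneg _) ?_
      simpa using norm_fderiv_le_of_lipschitz ℝ hf (x₀ := x)
  · refine Continuous.integrable_of_hasCompactSupport ?_ ?_
    · have := hψ.continuous_fderiv (by simp)
      have := hf.continuous
      fun_prop
    · refine (hc.fderiv ℝ).mono fun x hx h0 => hx ?_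
      simp [h0]

lemma distrib_clamp (Ω : Set (Euc d)) (c W : V) (f : Euc d → ℝ) (hf : LipschitzWith 1 f) :
    IsDistribGrad Ω (fun x => c + f x • W) (fun x => (fderiv ℝ f x).smulRight W) := by
  intro ψ ⟨hψ, hc, hs⟩
  have hz : ∀ x, x ∉ Ω → x ∉ tsupport ψ := fun x hx h => hx (interior_subset (hs h))
  rw [setIntegral_eq_integral_of_forall_compl_eq_zero,
    setIntegral_eq_integral_of_forall_compl_eq_zero]
  rotate_left
  · intro x hx
    have : ψ x = 0 := image_eq_zero_of_notMem_tsupport (hz x hx)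
    simp [frobInner, this]
  · intro x hx
    have : fderiv ℝ ψ x = 0 := by
      by_contra h
      exact hz x hx (support_fderiv_subset ℝ h)
    simp [divg, this]
  have h1 : ∀ x, ⟪c + f x • W, divg ψ x⟫ = ∑ i : Fin d,
      ((fun _ => (1:ℝ)) x * ⟪c, fderiv ℝ ψ x (EuclideanSpace.single i 1) (EuclideanSpace.single i 1)⟫ +
        f x * ⟪W, fderiv ℝ ψ x (EuclideanSpace.single i 1) (EuclideanSpace.single i 1)⟫) := by
    intro x
    simp [divg, inner_sum, inner_add_left, inner_smul_left]
  have h2 : ∀ x, frobInner ((fderiv ℝ f x).smulRight W) (ψ x) = ∑ i : Fin d,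
      fderiv ℝ f x (EuclideanSpace.single i 1) * ⟪W, ψ x (EuclideanSpace.single i 1)⟫ := by
    intro x
    simp [frobInner, inner_smul_left]
  have hone : LipschitzWith 1 (fun _ : Euc d => (1:ℝ)) := LipschitzWith.const' 1
  have A := fun i : Fin d => ibp_comp ψ hψ hc W f hf (EuclideanSpace.single i 1)
  have B := fun i : Fin d => ibp_comp ψ hψ hc c _ hone (EuclideanSpace.single i 1)
  simp_rw [h1, h2]
  rw [integral_finsetSum _ (fun i _ => by exact (B i).2.2.add (A i).2.2),
    integral_finsetSum _ (fun i _ => (A i).2.1), ← Finset.sum_neg_distrib]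
  refine Finset.sum_congr rfl fun i _ => ?_
  rw [integral_add (B i).2.2 (A i).2.2, (A i).1, neg_neg]
  have := (B i).1
  simp only [fderiv_fun_const, Pi.zero_apply, ContinuousLinearMap.zero_apply, zero_mul, integral_zero]
    at this
  linarith

lemma frobNorm_rank (L : Euc d →L[ℝ] ℝ) (W : V) :
    frobNorm (L.smulRight W) = ‖L‖ * ‖W‖ := by
  obtain ⟨v, rfl⟩ := (InnerProductSpace.toDual ℝ (Euc d)).surjective L
  rw [LinearIsometryEquiv.norm_map, frobNorm, EuclideanSpace.norm_eq]
  rw [← Real.sqrt_sq (norm_nonneg W), ← Real.sqrt_mul (by positivity)]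
  simp [norm_smul, mul_pow, Finset.sum_mul, EuclideanSpace.inner_single_right]

lemma frlip_clamp (Ω : Set (Euc d)) (c W : V) (hW : ‖W‖ ≤ 1) (f : Euc d → ℝ)
    (hf : LipschitzWith 1 f) : FrLipOn 1 Ω (fun x => c + f x • W) := by
  refine ⟨?_, _, ?_, ?_, distrib_clamp Ω c W f hf⟩
  · have := hf.continuous
    fun_prop
  · have h1 : StronglyMeasurable (fderiv ℝ f) := (measurable_fderiv ℝ f).stronglyMeasurable
    have h2 : Continuous (fun L : Euc d →L[ℝ] ℝ => L.smulRight W) := by fun_prop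
    exact (h2.comp_stronglyMeasurable h1).aestronglyMeasurable
  · refine .of_forall fun x => ?_
    rw [frobNorm_rank]
    refine mul_le_one₀ ?_ (norm_nonneg _) hW
    simpa using norm_fderiv_le_of_lipschitz ℝ hf (x₀ := x)

/-- for `μ = M₁ δ_{x₁}` and `ν = M₂ δ_{x₂}` with `x₁ ≠ x₂`, the
vector Kantorovich–Rubinstein value
`sup { ∫_Ω ⟨φ, ν-μ⟩_V : |∇φ|_{V^d,∞} ≤ 1, |φ|_{V,∞} ≤ λ }` (note
`∫_Ω ⟨φ, ν-μ⟩_V = ⟨φ(x₂), M₂⟩ - ⟨φ(x₁), M₁⟩`) equals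
`|x₁-x₂| · max { ⟨A,M₁⟩ - ⟨B,M₂⟩ : |A| ≤ γ, |B| ≤ γ, |A-B| ≤ 1 }` with
`γ = λ/|x₁-x₂|`. -/
theorem KR_two_diracs
    (Ω : Set (Euc d)) (hΩcomp : IsCompact Ω) (hΩconv : Convex ℝ Ω)
    (hΩint : (interior Ω).Nonempty)
    (lam : ℝ) (hlam : 0 < lam)
    (x₁ x₂ : Euc d) (hx₁ : x₁ ∈ Ω) (hx₂ : x₂ ∈ Ω) (hne : x₁ ≠ x₂)
    (M₁ M₂ : V) :
    sSup {r : ℝ | ∃ φ : Euc d → V, FrLipOn 1 Ω φ ∧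
        (∀ x ∈ Ω, ‖φ x‖ ≤ lam) ∧ r = ⟪φ x₂, M₂⟫ - ⟪φ x₁, M₁⟫} =
      ‖x₁ - x₂‖ *
        sSup {r : ℝ | ∃ A B : V, ‖A‖ ≤ lam / ‖x₁ - x₂‖ ∧
          ‖B‖ ≤ lam / ‖x₁ - x₂‖ ∧ ‖A - B‖ ≤ 1 ∧ r = ⟪A, M₁⟫ - ⟪B, M₂⟫} := by
  set D := ‖x₁ - x₂‖ with hDdef
  have hD : 0 < D := norm_pos_iff.2 (sub_ne_zero.2 hne)
  rw [← smul_eq_mul, ← Real.sSup_smul_of_nonneg hD.le]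
  congr 1
  ext r
  rw [mem_smul_set]
  constructor
  · rintro ⟨φ, hφ, hb, rfl⟩
    have hl := lip_all hΩcomp hΩconv hΩint hφ hx₂ hx₁
    have hsc : ∀ v : V, ‖-(D⁻¹ • v)‖ = ‖v‖ / D := fun v => by
      rw [norm_neg, norm_smul, norm_inv, Real.norm_of_nonneg hD.le, div_eq_inv_mul]
    refine ⟨_, ⟨-(D⁻¹ • φ x₁), -(D⁻¹ • φ x₂), ?_, ?_, ?_, rfl⟩, ?_⟩
    · rw [hsc]; exact div_le_div_of_nonneg_right (hb _ hx₁) hD.le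
    · rw [hsc]; exact div_le_div_of_nonneg_right (hb _ hx₂) hD.le
    · have : -(D⁻¹ • φ x₁) - -(D⁻¹ • φ x₂) = -(D⁻¹ • (φ x₁ - φ x₂)) := by
        rw [smul_sub]; abel
      rw [this, hsc, div_le_one hD]
      exact hl
    · simp only [inner_neg_left, inner_smul_left, smul_eq_mul, conj_trivial]
      field_simp
      ring
  · rintro ⟨_, ⟨A, B, hA, hB, hAB, rfl⟩, rfl⟩
    set e : Euc d := D⁻¹ • (x₂ - x₁) with he
    have hDn : ‖x₂ - x₁‖ = D := by rw [hDdef, norm_sub_rev]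
    have hen : ‖e‖ = 1 := by
      rw [he, norm_smul, norm_inv, Real.norm_of_nonneg hD.le, hDn, inv_mul_cancel₀ hD.ne']
    let f : Euc d → ℝ := fun x => max 0 (min D ⟪e, x - x₁⟫)
    have hf : LipschitzWith 1 f := by
      refine LipschitzWith.const_max (LipschitzWith.const_min ?_ _) _
      refine LipschitzWith.of_dist_le_mul fun x y => ?_
      rw [Real.dist_eq, ← inner_sub_right, sub_sub_sub_cancel_right, dist_eq_norm]
      refine (abs_real_inner_le_norm _ _).trans ?_
      simp [hen]
    have hf0 : ∀ x, 0 ≤ f x := fun x => le_max_left _ _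
    have hfD : ∀ x, f x ≤ D := fun x => max_le hD.le (min_le_left _ _)
    have hf1 : f x₁ = 0 := by simp [f, hD.le]
    have hf2 : f x₂ = D := by
      have : ⟪e, x₂ - x₁⟫ = D := by
        rw [he, inner_smul_left, real_inner_self_eq_norm_sq, hDn]
        simp only [conj_trivial]
        field_simp
      simp [f, this, hD.le]
    refine ⟨fun x => -(D • A) + f x • (A - B), frlip_clamp Ω _ _ hAB f hf, ?_, ?_⟩
    · intro x _
      have h1 : -(D • A) + f x • (A - B) = -((D - f x) • A + f x • B) := by
        rw [smul_sub, sub_smul]; abel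
      simp only
      rw [h1, norm_neg]
      refine (norm_add_le _ _).trans ?_
      rw [norm_smul, norm_smul, Real.norm_of_nonneg (hf0 x),
        Real.norm_of_nonneg (sub_nonneg.2 (hfD x))]
      have h2 := mul_le_mul_of_nonneg_left hA (sub_nonneg.2 (hfD x))
      have h3 := mul_le_mul_of_nonneg_left hB (hf0 x)
      have h4 : (D - f x) * (lam / D) + f x * (lam / D) = lam := by field_simp; ring
      linarith
    · simp only [hf1, hf2, zero_smul, add_zero, smul_eq_mul, inner_neg_left, inner_add_left,
        inner_smul_left, inner_sub_left, conj_trivial]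
      ring
end
end

section
/- Let Ω ⊂ ℝ be a compact interval containing distinct points x₁, x₂, let λ > 0, and let μ = m₁ δ_{x₁}, ν = m₂ δ_{x₂} with m₁, m₂ ∈ ℝ. Set γ = λ/|x₁−x₂|. Then the Kantorovich–Rubinstein value KR^λ(μ,ν) = sup{ ∫_Ω φ d(ν−μ) : φ 1-Lipschitz, |φ|_∞ ≤ λ } equals: λ(|m₁|+|m₂|) if γ ≤ 1/2 or sign(m₁) ≠ sign(m₂); λ(|m₂|−|m₁|) + |x₁−x₂||m₁| if m₂ ≥ m₁ ≥ 0 or 0 ≥ m₁ ≥ m₂; and λ(|m₁|−|m₂|) + |x₁−x₂||m₂| if m₁ ≥ m₂ ≥ 0 or 0 ≥ m₂ ≥ m₁ (these cases assumed with γ ≥ 1/2 where they overlap with the first). -/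
open Set

noncomputable section

/-- The scalar Kantorovich–Rubinstein (bounded-Lipschitz) value with parameter
`lam` between `μ = m₁ δ_{x₁}` and `ν = m₂ δ_{x₂}` on the interval `[a,b]`:
`sup { ∫ φ d(ν-μ) : φ 1-Lipschitz on [a,b], |φ|_∞ ≤ lam }`, where
`∫ φ d(ν-μ) = m₂ φ(x₂) - m₁ φ(x₁)`. -/
def KRdiracs (a b lam x₁ x₂ m₁ m₂ : ℝ) : ℝ :=
  sSup {r : ℝ | ∃ φ : ℝ → ℝ, ContinuousOn φ (Icc a b) ∧
    LipschitzOnWith 1 φ (Icc a b) ∧ (∀ x ∈ Icc a b, |φ x| ≤ lam) ∧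
    r = m₂ * φ x₂ - m₁ * φ x₁}

theorem KR_ext (lam p q u v : ℝ) (huv : u ≤ v) (hd : v - u ≤ |p - q|)
    (hu : |u| ≤ lam) (hv : |v| ≤ lam) :
    ∃ φ : ℝ → ℝ, LipschitzWith 1 φ ∧ (∀ x, |φ x| ≤ lam) ∧ φ p = u ∧ φ q = v := by
  refine ⟨fun x => max u (v - |x - q|), ?_, ?_, ?_, ?_⟩
  · apply LipschitzWith.of_dist_le_mul
    intro x y
    simp only [Real.dist_eq, NNReal.coe_one, one_mul]
    have h1 : |max u (v - |x - q|) - max u (v - |y - q|)| ≤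
        |(v - |x - q|) - (v - |y - q|)| := by
      have := abs_max_sub_max_le_abs (v - |x - q|) (v - |y - q|) u
      rwa [max_comm, max_comm (v - |y - q|)] at this
    have h2 := abs_abs_sub_abs_le_abs_sub (y - q) (x - q)
    have e1 : (v - |x - q|) - (v - |y - q|) = |y - q| - |x - q| := by ring
    have e2 : (y - q) - (x - q) = y - x := by ring
    rw [e1] at h1
    rw [e2, abs_sub_comm y x] at h2
    linarith
  · intro x
    rw [abs_le] at *
    have := abs_nonneg (x - q)
    exact ⟨le_trans hu.1 (le_max_left _ _), max_le hu.2 (by linarith [hv.2])⟩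
  · exact max_eq_left (by linarith)
  · simpa using huv

theorem KR_eq (a b lam x₁ x₂ m₁ m₂ S : ℝ) (hx₁ : x₁ ∈ Icc a b) (hx₂ : x₂ ∈ Icc a b)
    (hex : ∃ u v : ℝ, |u| ≤ lam ∧ |v| ≤ lam ∧ |v - u| ≤ |x₁ - x₂| ∧ S = m₂ * v - m₁ * u)
    (hub : ∀ u v : ℝ, |u| ≤ lam → |v| ≤ lam → |v - u| ≤ |x₁ - x₂| → m₂ * v - m₁ * u ≤ S) :
    KRdiracs a b lam x₁ x₂ m₁ m₂ = S := by
  apply IsGreatest.csSup_eq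
  constructor
  · obtain ⟨u, v, hu, hv, hd, rfl⟩ := hex
    have : ∃ φ : ℝ → ℝ, LipschitzWith 1 φ ∧ (∀ x, |φ x| ≤ lam) ∧ φ x₁ = u ∧ φ x₂ = v := by
      rcases le_total u v with h | h
      · exact KR_ext lam x₁ x₂ u v h (le_trans (le_abs_self _) hd) hu hv
      · rw [abs_sub_comm, abs_sub_comm x₁] at hd
        obtain ⟨φ, h1, h2, h3, h4⟩ :=
          KR_ext lam x₂ x₁ v u h (le_trans (le_abs_self _) hd) hv hu
        exact ⟨φ, h1, h2, h4, h3⟩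
    obtain ⟨φ, h1, h2, h3, h4⟩ := this
    exact ⟨φ, h1.continuous.continuousOn, h1.lipschitzOnWith, fun x _ => h2 x, by rw [h3, h4]⟩
  · rintro r ⟨φ, -, hL, hb, rfl⟩
    refine hub _ _ (hb _ hx₁) (hb _ hx₂) ?_
    have := hL.dist_le_mul _ hx₁ _ hx₂
    simp only [Real.dist_eq, NNReal.coe_one, one_mul] at this
    rwa [abs_sub_comm]

/-- closed form of the scalar Kantorovich–Rubinstein norm
between two Dirac masses `m₁ δ_{x₁}` and `m₂ δ_{x₂}`, with
`γ = λ/|x₁-x₂|`. -/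
theorem KRdiracs_closed_form
    (a b : ℝ) (hab : a < b) (lam : ℝ) (hlam : 0 < lam)
    (x₁ x₂ : ℝ) (hx₁ : x₁ ∈ Icc a b) (hx₂ : x₂ ∈ Icc a b) (hne : x₁ ≠ x₂)
    (m₁ m₂ : ℝ) :
    ((lam / |x₁ - x₂| ≤ 1 / 2 ∨ Real.sign m₁ ≠ Real.sign m₂) →
      KRdiracs a b lam x₁ x₂ m₁ m₂ = lam * (|m₁| + |m₂|)) ∧
    ((1 / 2 ≤ lam / |x₁ - x₂| ∧
        ((0 ≤ m₁ ∧ m₁ ≤ m₂) ∨ (m₂ ≤ m₁ ∧ m₁ ≤ 0))) →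
      KRdiracs a b lam x₁ x₂ m₁ m₂ =
        lam * (|m₂| - |m₁|) + |x₁ - x₂| * |m₁|) ∧
    ((1 / 2 ≤ lam / |x₁ - x₂| ∧
        ((0 ≤ m₂ ∧ m₂ ≤ m₁) ∨ (m₁ ≤ m₂ ∧ m₂ ≤ 0))) →
      KRdiracs a b lam x₁ x₂ m₁ m₂ =
        lam * (|m₁| - |m₂|) + |x₁ - x₂| * |m₂|) := by
  have hd : 0 < |x₁ - x₂| := abs_pos.mpr (sub_ne_zero.mpr hne)
  have hl : |lam| = lam := abs_of_pos hlam
  refine ⟨?_, ?_, ?_⟩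
  · intro h
    refine KR_eq a b lam x₁ x₂ m₁ m₂ _ hx₁ hx₂ ?_ ?_
    · have key : ∀ s t : ℝ, |s| = 1 → |t| = 1 → |m₁| = -(s * m₁) → |m₂| = t * m₂ →
          |t * lam - s * lam| ≤ |x₁ - x₂| →
          ∃ u v : ℝ, |u| ≤ lam ∧ |v| ≤ lam ∧ |v - u| ≤ |x₁ - x₂| ∧
            lam * (|m₁| + |m₂|) = m₂ * v - m₁ * u := by
        intro s t hs ht h1 h2 h3
        refine ⟨s * lam, t * lam, ?_, ?_, h3, ?_⟩
        · rw [abs_mul, hs, hl, one_mul]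
        · rw [abs_mul, ht, hl, one_mul]
        · rw [h1, h2]; ring
      have hone : |(-1 : ℝ)| = 1 := by norm_num
      have hz : ∀ s : ℝ, |s * lam - s * lam| ≤ |x₁ - x₂| := by
        intro s; simp
      have hfar : lam / |x₁ - x₂| ≤ 1 / 2 → 2 * lam ≤ |x₁ - x₂| := by
        intro h
        rw [div_le_iff₀ hd] at h
        linarith
      rcases lt_trichotomy m₁ 0 with p | p | p <;> rcases lt_trichotomy m₂ 0 with q | q | q
      · have h' := hfar (h.resolve_right (by simp [Real.sign_of_neg, p, q]))
        refine key 1 (-1) (by simp) hone (by rw [abs_of_neg p]; ring)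
          (by rw [abs_of_neg q]; ring) ?_
        rw [abs_of_neg (by linarith)]; linarith
      · exact key 1 1 (by simp) (by simp) (by rw [abs_of_neg p]; ring) (by simp [q]) (hz _)
      · exact key 1 1 (by simp) (by simp) (by rw [abs_of_neg p]; ring)
          (by rw [abs_of_pos q]; ring) (hz _)
      · exact key (-1) (-1) hone hone (by simp [p]) (by rw [abs_of_neg q]; ring) (hz _)
      · exact key 1 1 (by simp) (by simp) (by simp [p]) (by simp [q]) (hz _)
      · exact key 1 1 (by simp) (by simp) (by simp [p]) (by rw [abs_of_pos q]; ring) (hz _)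
      · exact key (-1) (-1) hone hone (by rw [abs_of_pos p]; ring)
          (by rw [abs_of_neg q]; ring) (hz _)
      · exact key (-1) (-1) hone hone (by rw [abs_of_pos p]; ring) (by simp [q]) (hz _)
      · have h' := hfar (h.resolve_right (by simp [Real.sign_of_pos, p, q]))
        refine key (-1) 1 hone (by simp) (by rw [abs_of_pos p]; ring)
          (by rw [abs_of_pos q]; ring) ?_
        rw [abs_of_pos (by linarith)]; linarith
    · intro u v hu hv _
      have h1 : m₂ * v ≤ |m₂| * lam := by
        calc m₂ * v ≤ |m₂ * v| := le_abs_self _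
          _ = |m₂| * |v| := abs_mul _ _
          _ ≤ _ := by gcongr
      have h2 : -(m₁ * u) ≤ |m₁| * lam := by
        calc -(m₁ * u) ≤ |m₁ * u| := neg_le_abs _
          _ = |m₁| * |u| := abs_mul _ _
          _ ≤ _ := by gcongr
      linarith
  all_goals
    rintro ⟨hg, h⟩
    rw [le_div_iff₀ hd] at hg
    refine KR_eq a b lam x₁ x₂ m₁ m₂ _ hx₁ hx₂ ?_ ?_ <;> generalize |x₁ - x₂| = d at *
  · rcases h with ⟨h1, h2⟩ | ⟨h1, h2⟩
    · refine ⟨lam - d, lam, abs_le.mpr ⟨by linarith, by linarith⟩, hl.le,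
        abs_le.mpr ⟨by linarith, by linarith⟩, ?_⟩
      rw [abs_of_nonneg h1, abs_of_nonneg (h1.trans h2)]; ring
    · refine ⟨-lam + d, -lam, abs_le.mpr ⟨by linarith, by linarith⟩, by rw [abs_neg, hl],
        abs_le.mpr ⟨by linarith, by linarith⟩, ?_⟩
      rw [abs_of_nonpos h2, abs_of_nonpos (h1.trans h2)]; ring
  · intro u v hu hv huv
    rw [abs_le] at hu hv huv
    rcases h with ⟨h1, h2⟩ | ⟨h1, h2⟩
    · rw [abs_of_nonneg h1, abs_of_nonneg (h1.trans h2)]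
      nlinarith [mul_nonneg (sub_nonneg.mpr h2) (sub_nonneg.mpr hv.2),
        mul_nonneg h1 (sub_nonneg.mpr huv.2)]
    · rw [abs_of_nonpos h2, abs_of_nonpos (h1.trans h2)]
      nlinarith [mul_nonneg (sub_nonneg.mpr h1) (sub_nonneg.mpr hv.1),
        mul_nonneg (neg_nonneg.mpr h2) (sub_nonneg.mpr huv.1)]
  · rcases h with ⟨h1, h2⟩ | ⟨h1, h2⟩
    · refine ⟨-lam, -lam + d, by rw [abs_neg, hl], abs_le.mpr ⟨by linarith, by linarith⟩,
        abs_le.mpr ⟨by linarith, by linarith⟩, ?_⟩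
      rw [abs_of_nonneg h1, abs_of_nonneg (h1.trans h2)]; ring
    · refine ⟨lam, lam - d, hl.le, abs_le.mpr ⟨by linarith, by linarith⟩,
        abs_le.mpr ⟨by linarith, by linarith⟩, ?_⟩
      rw [abs_of_nonpos h2, abs_of_nonpos (h1.trans h2)]; ring
  · intro u v hu hv huv
    rw [abs_le] at hu hv huv
    rcases h with ⟨h1, h2⟩ | ⟨h1, h2⟩
    · rw [abs_of_nonneg h1, abs_of_nonneg (h1.trans h2)]
      nlinarith [mul_nonneg (sub_nonneg.mpr h2) (sub_nonneg.mpr hu.1),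
        mul_nonneg h1 (sub_nonneg.mpr huv.2)]
    · rw [abs_of_nonpos h2, abs_of_nonpos (h1.trans h2)]
      nlinarith [mul_nonneg (sub_nonneg.mpr h1) (sub_nonneg.mpr hu.2),
        mul_nonneg (neg_nonneg.mpr h2) (sub_nonneg.mpr huv.1)]
end
end

section
/- Let G be a finite Cartesian grid with grid spacing (h_x, h_y), V a real finite-dimensional inner product space, λ > 0, and μ, ν ∈ F(G;V) discrete V-valued functions. Let ∇_X : F(G;V) → F(G;V^d) be the forward-difference discrete gradient and div_X its negative adjoint. Then the following duality formulas hold, and both primal problems admit solutions: (i) min{ |σ|_{X^d,1} + λ|δ|_{X,1} : σ ∈ F(G;V^d), δ ∈ F(G;V), div_X(σ) = μ−ν+δ } = max{ ⟨φ, ν−μ⟩_X : φ ∈ F(G;V), |∇_X φ|_{X^d,∞} ≤ 1, |φ|_{X,∞} ≤ λ }; (ii) min{ |σ|_{X^d,1} + (λ/2)|δ|²_{X,2} : div_X(σ) = μ−ν+δ } = max{ ⟨φ, ν−μ⟩_X − (1/(2λ))|φ|²_{X,2} : |∇_X φ|_{X^d,∞} ≤ 1 }; (iii) min{ (1/2)|σ|²_{X^d,2}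 + (λ/2)|δ|²_{X,2} : div_X(σ) = μ−ν+δ } = max{ ⟨φ, ν−μ⟩_X − (1/(2λ))|φ|²_{X,2} − (1/2)|∇_X φ|²_{X^d,2} : φ ∈ F(G;V) }. -/
open scoped RealInnerProductSpace

noncomputable section

variable {V : Type*} [NormedAddCommGroup V] [InnerProductSpace ℝ V]
  [FiniteDimensional ℝ V]
variable {Nx Ny : ℕ}

/-- Discrete inner product `⟨u,v⟩_X = h_x h_y ∑ ⟨u_{ij}, v_{ij}⟩_V` on
`F(G;V)`. -/
def ipX (hx hy : ℝ) (u v : Fin Nx × Fin Ny → V) : ℝ :=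
  hx * hy * ∑ p, ⟪u p, v p⟫

/-- Discrete inner product on `F(G;V^d)` (`d = 2`, Frobenius pairing). -/
def ipXd (hx hy : ℝ) (w z : Fin Nx × Fin Ny → V × V) : ℝ :=
  hx * hy * ∑ p, (⟪(w p).1, (z p).1⟫ + ⟪(w p).2, (z p).2⟫)

/-- Frobenius norm on `V^d = V × V` (`d = 2`). -/
def fnrm (a : V × V) : ℝ := Real.sqrt (‖a.1‖ ^ 2 + ‖a.2‖ ^ 2)

/-- Discrete `l¹` norm `|u|_{X,1}` on `F(G;V)`. -/
def n1X (hx hy : ℝ) (u : Fin Nx × Fin Ny → V) : ℝ := hx * hy * ∑ p, ‖u p‖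

/-- Discrete `l¹` norm `|w|_{X^d,1}` on `F(G;V^d)` (Frobenius norm). -/
def n1Xd (hx hy : ℝ) (w : Fin Nx × Fin Ny → V × V) : ℝ :=
  hx * hy * ∑ p, fnrm (w p)

/-- Discrete squared `l²` norm `|u|²_{X,2}` on `F(G;V)`. -/
def n2sqX (hx hy : ℝ) (u : Fin Nx × Fin Ny → V) : ℝ :=
  hx * hy * ∑ p, ‖u p‖ ^ 2

/-- Discrete squared `l²` norm `|w|²_{X^d,2}` on `F(G;V^d)`. -/
def n2sqXd (hx hy : ℝ) (w : Fin Nx × Fin Ny → V × V) : ℝ :=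
  hx * hy * ∑ p, (‖(w p).1‖ ^ 2 + ‖(w p).2‖ ^ 2)

/-- Successor index with the Neumann convention `u_{N+1} = u_N`. -/
def fnext {N : ℕ} (i : Fin N) : Fin N :=
  if h : (i : ℕ) + 1 < N then ⟨(i : ℕ) + 1, h⟩ else i

/-- Forward finite-difference discrete gradient
`(∇_X u)_{ij} = ((u_{i+1,j}-u_{ij})/h_x, (u_{i,j+1}-u_{ij})/h_y)`. -/
def gradX (hx hy : ℝ) (u : Fin Nx × Fin Ny → V) (p : Fin Nx × Fin Ny) :
    V × V :=
  (hx⁻¹ • (u (fnext p.1, p.2) - u p), hy⁻¹ • (u (p.1, fnext p.2) - u p))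

/-- The discrete divergence constraint `div_X σ = r`, expressed through the
defining duality `⟨div_X σ, u⟩_X = -⟨σ, ∇_X u⟩_{X^d}` for all `u`. -/
def DivC (hx hy : ℝ) (σ : Fin Nx × Fin Ny → V × V)
    (r : Fin Nx × Fin Ny → V) : Prop :=
  ∀ u : Fin Nx × Fin Ny → V, -(ipXd hx hy σ (gradX hx hy u)) = ipX hx hy r u


theorem sep_lemma {W : Type*} [NormedAddCommGroup W] [NormedSpace ℝ W]
    (N : W → ℝ) (hc : Continuous N) (hN : ConvexOn ℝ Set.univ N) (K : Submodule ℝ W) (w0 : W)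
    (hmin : ∀ k ∈ K, N w0 ≤ N (w0 + k)) :
    ∃ f : W →ₗ[ℝ] ℝ, (∀ k ∈ K, f k = 0) ∧ ∀ w, N w0 + f (w - w0) ≤ N w := by
  have ho : IsOpen {p : W × ℝ | N p.1 < p.2} := isOpen_lt (by fun_prop) (by fun_prop)
  have hs : Convex ℝ {p : W × ℝ | N p.1 < p.2} := by
    have := hN.convex_strict_epigraph
    simpa using this
  have ht : Convex ℝ {p : W × ℝ | p.1 - w0 ∈ K ∧ p.2 = N w0} := by
    rintro ⟨x, s⟩ ⟨hx, rfl⟩ ⟨y, t⟩ ⟨hy, hyt⟩ a b ha hb hab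
    simp only at hx hy hyt
    subst hyt
    refine ⟨?_, ?_⟩
    · have : a • x + b • y - w0 = a • (x - w0) + b • (y - w0) := by
        have : w0 = (a + b) • w0 := by rw [hab, one_smul]
        rw [add_smul] at this
        nth_rewrite 1 [this]
        module
      simpa [this] using K.add_mem (K.smul_mem a hx) (K.smul_mem b hy)
    · simp [← add_mul, hab]
  obtain ⟨f, u, h1, h2⟩ := geometric_hahn_banach_open hs ho ht (by
    rw [Set.disjoint_left]
    rintro ⟨x, s⟩ hx ⟨hk, hs⟩
    simp only [Set.mem_ofPred_eq] at hx hk hs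
    have := hmin _ hk
    simp at this
    linarith)
  set g : W →ₗ[ℝ] ℝ := f.toLinearMap ∘ₗ LinearMap.inl ℝ W ℝ with hg
  set c : ℝ := f (0, 1) with hcdef
  have hf : ∀ w t, f (w, t) = g w + t * c := by
    intro w t
    have : ((w, t) : W × ℝ) = (w, 0) + t • (0, 1) := by simp
    rw [this, map_add, map_smul]; simp [hg, hcdef]
  have h2' : ∀ k ∈ K, u ≤ g w0 + g k + N w0 * c := by
    intro k hk
    have := h2 (w0 + k, N w0) (by simpa using hk)
    rw [hf, map_add] at this; exact this
  have h1' : ∀ w t, N w < t → g w + t * c < u := by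
    intro w t h
    have := h1 (w, t) h
    rwa [hf] at this
  have h20 : u ≤ g w0 + N w0 * c := by simpa using h2' 0 K.zero_mem
  have hc0 : c < 0 := by
    have := h1' w0 (N w0 + 1) (by linarith)
    nlinarith
  have hK : ∀ k ∈ K, g k = 0 := by
    intro k hk
    by_contra hne
    have := h2' (((u - 1 - g w0 - N w0 * c) / g k) • k) (K.smul_mem _ hk)
    rw [map_smul, smul_eq_mul, div_mul_cancel₀ _ hne] at this
    linarith
  refine ⟨(-c)⁻¹ • g, fun k hk => by simp [hK k hk], fun w => ?_⟩
  have h3 : g w + N w * c ≤ g w0 + N w0 * c := by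
    apply le_of_forall_pos_le_add
    intro e he
    have := h1' w (N w + e / (-c)) (by have : 0 < e / (-c) := div_pos he (by linarith); linarith)
    have h5 : e / (-c) * c = -e := by
      have := hc0.ne
      rw [div_neg, neg_mul, div_mul_cancel₀ _ this]
    rw [add_mul, h5] at this
    linarith
  have : (-c)⁻¹ * (g w - g w0) ≤ N w - N w0 := by
    rw [inv_mul_le_iff₀ (by linarith)]; linarith
  simp only [LinearMap.smul_apply, map_sub, smul_eq_mul]
  linarith

theorem annih_lemma {W E : Type*} [AddCommGroup W] [Module ℝ W] [FiniteDimensional ℝ W]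
    [AddCommGroup E] [Module ℝ E]
    (l : E →ₗ[ℝ] Module.Dual ℝ W) (f : W →ₗ[ℝ] ℝ)
    (h : ∀ w, (∀ e, l e w = 0) → f w = 0) : ∃ e, l e = f := by
  have : f ∈ (LinearMap.range l).dualCoannihilator.dualAnnihilator := by
    rw [Submodule.mem_dualAnnihilator]
    intro w hw
    apply h
    intro e
    exact (Submodule.mem_dualCoannihilator _).1 hw _ ⟨e, rfl⟩
  rw [Subspace.dualCoannihilator_dualAnnihilator_eq] at this
  exact this

def pair (hx hy : ℝ) : (Fin Nx × Fin Ny → V) →ₗ[ℝ]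
    Module.Dual ℝ ((Fin Nx × Fin Ny → V × V) × (Fin Nx × Fin Ny → V)) :=
  LinearMap.mk₂ ℝ (fun u w => ipXd hx hy w.1 (gradX hx hy u) + ipX hx hy w.2 u)
    (by
      intro u u' w
      simp only [ipXd, ipX, gradX, Pi.add_apply, ← mul_add, ← Finset.sum_add_distrib]
      congr 1; apply Finset.sum_congr rfl; intro p _
      simp only [inner_smul_right, inner_sub_right, inner_add_right]; ring)
    (by
      intro c u w
      simp only [ipXd, ipX, gradX, Pi.smul_apply, ← mul_add, ← Finset.sum_add_distrib, smul_eq_mul]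
      rw [mul_left_comm, Finset.mul_sum (a := c)]
      congr 1; apply Finset.sum_congr rfl; intro p _
      simp only [inner_smul_right, inner_sub_right, inner_add_right]; ring)
    (by
      intro w u u'
      simp only [ipXd, ipX, Pi.add_apply, ← mul_add, ← Finset.sum_add_distrib,
        Prod.fst_add, Prod.snd_add]
      congr 1; apply Finset.sum_congr rfl; intro p _
      simp only [inner_add_left]; ring)
    (by
      intro c w u
      simp only [ipXd, ipX, Pi.smul_apply, Prod.smul_fst, Prod.smul_snd, ← mul_add,
        ← Finset.sum_add_distrib, smul_eq_mul]
      rw [mul_left_comm, Finset.mul_sum (a := c)]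
      congr 1; apply Finset.sum_congr rfl; intro p _
      simp only [real_inner_smul_left]; ring)

theorem divC_iff (hx hy : ℝ) (μ ν δ : Fin Nx × Fin Ny → V) (σ : Fin Nx × Fin Ny → V × V) :
    DivC hx hy σ (fun p => μ p - ν p + δ p) ↔
      ∀ u, ipXd hx hy σ (gradX hx hy u) + ipX hx hy δ u = ipX hx hy u (fun p => ν p - μ p) := by
  have key : ∀ u : Fin Nx × Fin Ny → V, ipX hx hy (fun p => μ p - ν p + δ p) u =
      ipX hx hy δ u - ipX hx hy u (fun p => ν p - μ p) := by
    intro u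
    simp only [ipX, ← mul_sub, ← Finset.sum_sub_distrib]
    congr 1; apply Finset.sum_congr rfl; intro p _
    simp only [inner_add_left, inner_sub_left, inner_sub_right, real_inner_comm]; ring
  unfold DivC
  refine forall_congr' fun u => ?_
  rw [key]
  constructor <;> intro h <;> linarith

abbrev GW (V : Type*) (Nx Ny : ℕ) := (Fin Nx × Fin Ny → V × V) × (Fin Nx × Fin Ny → V)

theorem main_lemma (hx hy : ℝ) (hhx : 0 < hx) (hhy : 0 < hy) (μ ν : Fin Nx × Fin Ny → V)
    (a : V × V → ℝ) (b : V → ℝ) (k : ℝ)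
    (ha : Continuous a) (hb : Continuous b) (hac : ConvexOn ℝ Set.univ a)
    (hbc : ConvexOn ℝ Set.univ b) (ha0 : ∀ x, 0 ≤ a x) (hb0 : ∀ x, 0 ≤ b x) (hk : 0 < k)
    (hak : ∀ x, ‖x‖ ≤ k * (a x + 1)) (hbk : ∀ x, ‖x‖ ≤ k * (b x + 1)) :
    ∃ (σ : Fin Nx × Fin Ny → V × V) (δ φ : Fin Nx × Fin Ny → V),
      DivC hx hy σ (fun p => μ p - ν p + δ p) ∧
      (∀ p x, a (σ p) + (⟪x.1 - (σ p).1, (gradX hx hy φ p).1⟫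
        + ⟪x.2 - (σ p).2, (gradX hx hy φ p).2⟫) ≤ a x) ∧
      (∀ p y, b (δ p) + ⟪y - δ p, φ p⟫ ≤ b y) := by
  have hh : 0 < hx * hy := mul_pos hhx hhy
  let N : GW V Nx Ny → ℝ := fun w => hx * hy * (∑ p, a (w.1 p) + ∑ p, b (w.2 p))
  have hNc : Continuous N := by fun_prop
  have hNconv : ConvexOn ℝ Set.univ N := by
    refine ⟨convex_univ, ?_⟩
    intro x _ y _ s t hs ht hst
    have e : s • N x + t • N y = hx * hy * (∑ p, (s * a (x.1 p) + t * a (y.1 p)) +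
        ∑ p, (s * b (x.2 p) + t * b (y.2 p))) := by
      simp only [N, smul_eq_mul, Finset.sum_add_distrib, ← Finset.mul_sum]; ring
    rw [e]
    apply mul_le_mul_of_nonneg_left _ hh.le
    apply add_le_add <;> apply Finset.sum_le_sum <;> intro p _
    · exact hac.2 (Set.mem_univ (x.1 p)) (Set.mem_univ (y.1 p)) hs ht hst
    · exact hbc.2 (Set.mem_univ (x.2 p)) (Set.mem_univ (y.2 p)) hs ht hst
  let S : Set (GW V Nx Ny) := {w | ∀ u, pair hx hy u w = ipX hx hy u (fun p => ν p - μ p)}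
  have hS : IsClosed S := by
    have : S = ⋂ u, {w | pair hx hy u w = ipX hx hy u (fun p => ν p - μ p)} := by
      ext w; rw [Set.mem_iInter]; rfl
    rw [this]
    apply isClosed_iInter
    intro u
    exact isClosed_eq (LinearMap.continuous_of_finiteDimensional _) continuous_const
  let w1 : GW V Nx Ny := (0, fun p => ν p - μ p)
  have hw1 : w1 ∈ S := by
    intro u
    simp [pair, w1, ipXd, ipX, real_inner_comm]
  have hbd : ∀ w, N w ≤ N w1 → ‖w‖ ≤ k * (N w1 / (hx * hy) + 1) := by
    intro w hw
    have hw' : ∑ p, a (w.1 p) + ∑ p, b (w.2 p) ≤ N w1 / (hx * hy) := by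
      rw [le_div_iff₀ hh, mul_comm]; exact hw
    have hA : 0 ≤ ∑ p, a (w.1 p) := Finset.sum_nonneg fun p _ => ha0 _
    have hB : 0 ≤ ∑ p, b (w.2 p) := Finset.sum_nonneg fun p _ => hb0 _
    have hR : 0 ≤ k * (N w1 / (hx * hy) + 1) := by
      apply mul_nonneg hk.le; linarith
    rw [Prod.norm_def, max_le_iff, pi_norm_le_iff_of_nonneg hR, pi_norm_le_iff_of_nonneg hR]
    constructor
    · intro p
      refine (hak _).trans (mul_le_mul_of_nonneg_left ?_ hk.le)
      have := Finset.single_le_sum (f := fun p => a (w.1 p)) (fun p _ => ha0 _) (Finset.mem_univ p)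
      linarith
    · intro p
      refine (hbk _).trans (mul_le_mul_of_nonneg_left ?_ hk.le)
      have := Finset.single_le_sum (f := fun p => b (w.2 p)) (fun p _ => hb0 _) (Finset.mem_univ p)
      linarith
  have : ∃ w0 ∈ S, ∀ w ∈ S, N w0 ≤ N w := by
    have hcpt : IsCompact (S ∩ Metric.closedBall (0 : GW V Nx Ny) (k * (N w1 / (hx * hy) + 1))) :=
      (isCompact_closedBall _ _).inter_left hS
    obtain ⟨w0, hw0, hm⟩ := hcpt.exists_isMinOn
      ⟨w1, hw1, by simpa using hbd w1 le_rfl⟩ hNc.continuousOn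
    refine ⟨w0, hw0.1, fun w hw => ?_⟩
    by_cases h : N w ≤ N w1
    · exact hm ⟨hw, by simpa using hbd w h⟩
    · exact (hm ⟨hw1, by simpa using hbd w1 le_rfl⟩ : N w0 ≤ N w1).trans (not_le.1 h).le
  obtain ⟨w0, hw0, hm⟩ := this
  let K : Submodule ℝ (GW V Nx Ny) := (LinearMap.range (pair (V := V) (Nx := Nx) (Ny := Ny) hx hy)).dualCoannihilator
  have hKm : ∀ w : GW V Nx Ny, w ∈ K ↔ ∀ u, pair hx hy u w = 0 := by
    intro w
    rw [Submodule.mem_dualCoannihilator]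
    exact ⟨fun h u => h _ ⟨u, rfl⟩, by rintro h _ ⟨u, rfl⟩; exact h u⟩
  obtain ⟨f, hf0, hf⟩ := sep_lemma N hNc hNconv K w0 (by
    intro k hk
    apply hm
    intro u
    rw [map_add, (hKm k).1 hk u, add_zero, hw0 u])
  obtain ⟨φ, hφ⟩ := annih_lemma (pair hx hy) f (fun w hw => hf0 w ((hKm w).2 hw))
  refine ⟨w0.1, w0.2, φ, (divC_iff ..).2 fun u => hw0 u, ?_, ?_⟩
  · intro p x
    have := hf (w0 + (Pi.single p (x - w0.1 p), 0))
    rw [← hφ, add_sub_cancel_left] at this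
    have e1 : pair hx hy φ ((Pi.single p (x - w0.1 p), 0) : GW V Nx Ny) = hx * hy *
       (⟪x.1 - (w0.1 p).1, (gradX hx hy φ p).1⟫ + ⟪x.2 - (w0.1 p).2, (gradX hx hy φ p).2⟫) := by
      simp only [pair, LinearMap.mk₂_apply, ipXd, ipX]
      rw [Finset.sum_eq_single p]
      · simp
      · intro q _ hq; simp [Pi.single_eq_of_ne hq]
      · simp
    have e2 : N (w0 + (Pi.single p (x - w0.1 p), 0)) = N w0 + hx * hy * (a x - a (w0.1 p)) := by
      have : ∑ q, a (w0.1 q + (Pi.single p (x - w0.1 p) : Fin Nx × Fin Ny → V × V) q)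
          - ∑ q, a (w0.1 q) = a x - a (w0.1 p) := by
        rw [← Finset.sum_sub_distrib, Finset.sum_eq_single p]
        · simp
        · intro q _ hq; simp [Pi.single_eq_of_ne hq]
        · simp
      simp only [N, Prod.fst_add, Prod.snd_add, Pi.add_apply, Pi.zero_apply, add_zero]
      rw [← this]; ring
    rw [e1, e2] at this
    have := le_of_mul_le_mul_left (add_le_add_iff_left _ |>.1 this) hh
    linarith
  · intro p y
    have := hf (w0 + (0, Pi.single p (y - w0.2 p)))
    rw [← hφ, add_sub_cancel_left] at this
    have e1 : pair hx hy φ ((0, Pi.single p (y - w0.2 p)) : GW V Nx Ny) = hx * hy *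
       (⟪y - w0.2 p, φ p⟫) := by
      simp only [pair, LinearMap.mk₂_apply, ipXd, ipX]
      rw [Finset.sum_eq_single p (f := fun q => ⟪(Pi.single p (y - w0.2 p) : Fin Nx × Fin Ny → V) q, φ q⟫)]
      · simp
      · intro q _ hq; simp [Pi.single_eq_of_ne hq]
      · simp
    have e2 : N (w0 + (0, Pi.single p (y - w0.2 p))) = N w0 + hx * hy * (b y - b (w0.2 p)) := by
      have : ∑ q, b (w0.2 q + (Pi.single p (y - w0.2 p) : Fin Nx × Fin Ny → V) q)
          - ∑ q, b (w0.2 q) = b y - b (w0.2 p) := by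
        rw [← Finset.sum_sub_distrib, Finset.sum_eq_single p]
        · simp
        · intro q _ hq; simp [Pi.single_eq_of_ne hq]
        · simp
      simp only [N, Prod.fst_add, Prod.snd_add, Pi.add_apply, Pi.zero_apply, add_zero]
      rw [← this]; ring
    rw [e1, e2] at this
    have := le_of_mul_le_mul_left (add_le_add_iff_left _ |>.1 this) hh
    linarith

theorem fnrm_eq (a : V × V) : fnrm a = ‖WithLp.toLp 2 a‖ := by
  rw [WithLp.prod_norm_eq_of_L2]; rfl

theorem fnrm_nonneg (a : V × V) : 0 ≤ fnrm a := Real.sqrt_nonneg _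

theorem fnrm_sq (a : V × V) : fnrm a ^ 2 = ‖a.1‖ ^ 2 + ‖a.2‖ ^ 2 :=
  Real.sq_sqrt (by positivity)

theorem fnrm_add_le (a b : V × V) : fnrm (a + b) ≤ fnrm a + fnrm b := by
  simp only [fnrm_eq, WithLp.toLp_add]; exact norm_add_le _ _

theorem fnrm_smul (c : ℝ) (a : V × V) : fnrm (c • a) = |c| * fnrm a := by
  simp only [fnrm_eq, WithLp.toLp_smul, norm_smul, Real.norm_eq_abs]

theorem fnrm_cs (a b : V × V) : ⟪a.1, b.1⟫ + ⟪a.2, b.2⟫ ≤ fnrm a * fnrm b := by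
  rw [fnrm_eq, fnrm_eq]
  exact real_inner_le_norm (WithLp.toLp 2 a) (WithLp.toLp 2 b)

theorem fnrm_cont : Continuous (fnrm : V × V → ℝ) := by unfold fnrm; fun_prop

theorem fnrm_conv : ConvexOn ℝ Set.univ (fnrm : V × V → ℝ) := by
  refine ⟨convex_univ, fun x _ y _ s t hs ht _ => ?_⟩
  refine (fnrm_add_le _ _).trans ?_
  rw [fnrm_smul, fnrm_smul, abs_of_nonneg hs, abs_of_nonneg ht]; rfl

theorem norm_le_fnrm (x : V × V) : ‖x‖ ≤ fnrm x := by
  rw [Prod.norm_def, max_le_iff]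
  constructor <;> apply Real.le_sqrt_of_sq_le <;> nlinarith [sq_nonneg ‖x.1‖, sq_nonneg ‖x.2‖]

theorem nsq_conv : ConvexOn ℝ Set.univ (fun x : V => ‖x‖ ^ 2) :=
  (convexOn_norm convex_univ).pow (fun _ _ => norm_nonneg _) 2

theorem hfnrm2_conv : ConvexOn ℝ Set.univ (fun x : V × V => 1 / 2 * fnrm x ^ 2) := by
  have h1 : ConvexOn ℝ Set.univ (fun x : V × V => fnrm x ^ 2) :=
    fnrm_conv.pow (fun x _ => fnrm_nonneg x) 2
  exact h1.smul (c := (1 / 2 : ℝ)) (by norm_num)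

theorem sub_fnrm (s g : V × V)
    (h : ∀ x : V × V, fnrm s + (⟪x.1 - s.1, g.1⟫ + ⟪x.2 - s.2, g.2⟫) ≤ fnrm x) :
    fnrm g ≤ 1 ∧ ⟪s.1, g.1⟫ + ⟪s.2, g.2⟫ = fnrm s := by
  have h0 := h 0
  have h1 := h (s + g)
  have hz : fnrm (0 : V × V) = 0 := by simp [fnrm]
  simp only [hz, Prod.fst_zero, Prod.snd_zero, zero_sub, inner_neg_left] at h0
  simp only [Prod.fst_add, Prod.snd_add, add_sub_cancel_left, real_inner_self_eq_norm_sq,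
    ← fnrm_sq] at h1
  have h2 := fnrm_add_le s g
  have hg : fnrm g ≤ 1 := by
    by_contra hc
    nlinarith [fnrm_nonneg g]
  refine ⟨hg, le_antisymm ?_ (by linarith)⟩
  have := fnrm_cs s g
  nlinarith [fnrm_nonneg s]

theorem sub_norm (c : ℝ) (s g : V) (hc0 : 0 < c)
    (h : ∀ x : V, c * ‖s‖ + ⟪x - s, g⟫ ≤ c * ‖x‖) :
    ‖g‖ ≤ c ∧ ⟪s, g⟫ = c * ‖s‖ := by
  have h0 := h 0
  have h1 := h (s + g)
  simp only [norm_zero, zero_sub, inner_neg_left] at h0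
  simp only [add_sub_cancel_left, real_inner_self_eq_norm_sq] at h1
  have h2 := norm_add_le s g
  have hg : ‖g‖ ≤ c := by
    by_contra hc
    nlinarith [norm_nonneg g]
  refine ⟨hg, le_antisymm ?_ (by linarith)⟩
  have := real_inner_le_norm s g
  nlinarith [norm_nonneg s]

theorem young (c : ℝ) (s g : V) (hc0 : 0 < c) :
    ⟪s, g⟫ ≤ c / 2 * ‖s‖ ^ 2 + 1 / (2 * c) * ‖g‖ ^ 2 := by
  have h := real_inner_le_norm s g
  have : c / 2 * ‖s‖ ^ 2 + 1 / (2 * c) * ‖g‖ ^ 2 - ‖s‖ * ‖g‖ =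
      1 / (2 * c) * (c * ‖s‖ - ‖g‖) ^ 2 := by field_simp; ring
  have : 0 ≤ 1 / (2 * c) * (c * ‖s‖ - ‖g‖) ^ 2 := by positivity
  linarith

theorem subg_sq (c : ℝ) (s g : V) (hc0 : 0 < c)
    (h : ∀ x : V, c / 2 * ‖s‖ ^ 2 + ⟪x - s, g⟫ ≤ c / 2 * ‖x‖ ^ 2) :
    ⟪s, g⟫ = c / 2 * ‖s‖ ^ 2 + 1 / (2 * c) * ‖g‖ ^ 2 := by
  apply le_antisymm (young c s g hc0)
  have h1 := h (c⁻¹ • g)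
  rw [norm_smul, inner_sub_left, real_inner_smul_left, real_inner_self_eq_norm_sq,
    Real.norm_eq_abs, abs_of_pos (inv_pos.2 hc0)] at h1
  have e : c / 2 * (c⁻¹ * ‖g‖) ^ 2 = c⁻¹ * ‖g‖ ^ 2 - 1 / (2 * c) * ‖g‖ ^ 2 := by
    field_simp; ring
  linarith

theorem weak_le (hx hy : ℝ) (hhx : 0 < hx) (hhy : 0 < hy) (μ ν δ φ : Fin Nx × Fin Ny → V)
    (σ : Fin Nx × Fin Ny → V × V) (α β : Fin Nx × Fin Ny → ℝ)
    (hd : DivC hx hy σ (fun p => μ p - ν p + δ p))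
    (ha : ∀ p, ⟪(σ p).1, (gradX hx hy φ p).1⟫ + ⟪(σ p).2, (gradX hx hy φ p).2⟫ ≤ α p)
    (hb : ∀ p, ⟪δ p, φ p⟫ ≤ β p) :
    ipX hx hy φ (fun p => ν p - μ p) ≤ hx * hy * (∑ p, α p) + hx * hy * (∑ p, β p) := by
  rw [← (divC_iff ..).1 hd φ]
  have hh : 0 ≤ hx * hy := (mul_pos hhx hhy).le
  exact add_le_add (mul_le_mul_of_nonneg_left (Finset.sum_le_sum fun p _ => ha p) hh)
    (mul_le_mul_of_nonneg_left (Finset.sum_le_sum fun p _ => hb p) hh)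

theorem strong_eq (hx hy : ℝ) (μ ν δ φ : Fin Nx × Fin Ny → V)
    (σ : Fin Nx × Fin Ny → V × V) (α β : Fin Nx × Fin Ny → ℝ)
    (hd : DivC hx hy σ (fun p => μ p - ν p + δ p))
    (ha : ∀ p, ⟪(σ p).1, (gradX hx hy φ p).1⟫ + ⟪(σ p).2, (gradX hx hy φ p).2⟫ = α p)
    (hb : ∀ p, ⟪δ p, φ p⟫ = β p) :
    ipX hx hy φ (fun p => ν p - μ p) = hx * hy * (∑ p, α p) + hx * hy * (∑ p, β p) := by
  rw [← (divC_iff ..).1 hd φ]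
  simp only [ipXd, ipX, ha, hb]

theorem part1 (hx hy : ℝ) (hhx : 0 < hx) (hhy : 0 < hy)
    (lam : ℝ) (hlam : 0 < lam) (μ ν : Fin Nx × Fin Ny → V) :
    ∃ (σ : Fin Nx × Fin Ny → V × V) (δ φ : Fin Nx × Fin Ny → V),
      DivC hx hy σ (fun p => μ p - ν p + δ p) ∧
      (∀ p, fnrm (gradX hx hy φ p) ≤ 1) ∧ (∀ p, ‖φ p‖ ≤ lam) ∧
      n1Xd hx hy σ + lam * n1X hx hy δ =
        ipX hx hy φ (fun p => ν p - μ p) ∧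
      (∀ (σ' : Fin Nx × Fin Ny → V × V) (δ' φ' : Fin Nx × Fin Ny → V),
        DivC hx hy σ' (fun p => μ p - ν p + δ' p) →
        (∀ p, fnrm (gradX hx hy φ' p) ≤ 1) → (∀ p, ‖φ' p‖ ≤ lam) →
        ipX hx hy φ' (fun p => ν p - μ p) ≤ n1Xd hx hy σ' + lam * n1X hx hy δ') := by
  obtain ⟨σ, δ, φ, hd, h1, h2⟩ := main_lemma hx hy hhx hhy μ ν fnrm (fun y => lam * ‖y‖)
    (1 + lam⁻¹) fnrm_cont (by fun_prop) fnrm_conv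
    ((convexOn_norm convex_univ).smul hlam.le) fnrm_nonneg (fun x => by positivity)
    (by positivity)
    (fun x => by
      have := norm_le_fnrm x
      have h3 : 0 ≤ lam⁻¹ * (fnrm x + 1) := mul_nonneg (by positivity) (by linarith [fnrm_nonneg x])
      linarith)
    (fun x => by
      have h3 : (1 + lam⁻¹) * (lam * ‖x‖ + 1) = ‖x‖ + (lam * ‖x‖ + 1 + lam⁻¹) := by
        field_simp; ring
      have : 0 ≤ lam * ‖x‖ + 1 + lam⁻¹ := by positivity
      linarith)
  have e : ∀ (σ : Fin Nx × Fin Ny → V × V) (δ : Fin Nx × Fin Ny → V),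
      hx * hy * (∑ p, fnrm (σ p)) + hx * hy * (∑ p, lam * ‖δ p‖) =
        n1Xd hx hy σ + lam * n1X hx hy δ := by
    intro σ δ
    simp only [n1Xd, n1X, ← Finset.mul_sum]; ring
  refine ⟨σ, δ, φ, hd, fun p => (sub_fnrm _ _ (h1 p)).1, fun p => (sub_norm _ _ _ hlam (h2 p)).1,
    ?_, ?_⟩
  · rw [← e]
    exact (strong_eq hx hy μ ν δ φ σ _ _ hd (fun p => (sub_fnrm _ _ (h1 p)).2)
      (fun p => (sub_norm _ _ _ hlam (h2 p)).2)).symm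
  · intro σ' δ' φ' hd' hg hl
    rw [← e]
    refine weak_le hx hy hhx hhy μ ν δ' φ' σ' _ _ hd' (fun p => ?_) (fun p => ?_)
    · exact (fnrm_cs _ _).trans (mul_le_of_le_one_right (fnrm_nonneg _) (hg p))
    · refine (real_inner_le_norm _ _).trans ?_
      rw [mul_comm]
      exact mul_le_mul_of_nonneg_right (hl p) (norm_nonneg _)

theorem coer_sq (lam : ℝ) (hlam : 0 < lam) (x : V) :
    ‖x‖ ≤ (1 + lam⁻¹) * (lam / 2 * ‖x‖ ^ 2 + 1) := by
  have h3 : (1 + lam⁻¹) * (lam / 2 * ‖x‖ ^ 2 + 1) =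
      ‖x‖ ^ 2 / 2 + 1 + (lam / 2 * ‖x‖ ^ 2 + lam⁻¹) := by
    field_simp; ring
  have : 0 ≤ lam / 2 * ‖x‖ ^ 2 + lam⁻¹ := by positivity
  nlinarith [sq_nonneg (‖x‖ - 1)]

theorem part2 (hx hy : ℝ) (hhx : 0 < hx) (hhy : 0 < hy)
    (lam : ℝ) (hlam : 0 < lam) (μ ν : Fin Nx × Fin Ny → V) :
    ∃ (σ : Fin Nx × Fin Ny → V × V) (δ φ : Fin Nx × Fin Ny → V),
      DivC hx hy σ (fun p => μ p - ν p + δ p) ∧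
      (∀ p, fnrm (gradX hx hy φ p) ≤ 1) ∧
      n1Xd hx hy σ + lam / 2 * n2sqX hx hy δ =
        ipX hx hy φ (fun p => ν p - μ p) - 1 / (2 * lam) * n2sqX hx hy φ ∧
      (∀ (σ' : Fin Nx × Fin Ny → V × V) (δ' φ' : Fin Nx × Fin Ny → V),
        DivC hx hy σ' (fun p => μ p - ν p + δ' p) →
        (∀ p, fnrm (gradX hx hy φ' p) ≤ 1) →
        ipX hx hy φ' (fun p => ν p - μ p) - 1 / (2 * lam) * n2sqX hx hy φ' ≤
          n1Xd hx hy σ' + lam / 2 * n2sqX hx hy δ') := by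
  obtain ⟨σ, δ, φ, hd, h1, h2⟩ := main_lemma hx hy hhx hhy μ ν fnrm (fun y => lam / 2 * ‖y‖ ^ 2)
    (1 + lam⁻¹) fnrm_cont (by fun_prop) fnrm_conv
    (nsq_conv.smul (by positivity)) fnrm_nonneg (fun x => by positivity)
    (by positivity)
    (fun x => by
      have := norm_le_fnrm x
      have h3 : 0 ≤ lam⁻¹ * (fnrm x + 1) := mul_nonneg (by positivity) (by linarith [fnrm_nonneg x])
      linarith)
    (coer_sq lam hlam)
  have e : ∀ (σ : Fin Nx × Fin Ny → V × V) (δ φ : Fin Nx × Fin Ny → V),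
      hx * hy * (∑ p, fnrm (σ p)) +
        hx * hy * (∑ p, (lam / 2 * ‖δ p‖ ^ 2 + 1 / (2 * lam) * ‖φ p‖ ^ 2)) =
        n1Xd hx hy σ + lam / 2 * n2sqX hx hy δ + 1 / (2 * lam) * n2sqX hx hy φ := by
    intro σ δ φ
    simp only [n1Xd, n2sqX, ← Finset.mul_sum, Finset.sum_add_distrib]; ring
  refine ⟨σ, δ, φ, hd, fun p => (sub_fnrm _ _ (h1 p)).1, ?_, ?_⟩
  · rw [eq_sub_iff_add_eq, ← e]
    exact (strong_eq hx hy μ ν δ φ σ _ _ hd (fun p => (sub_fnrm _ _ (h1 p)).2)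
      (fun p => subg_sq _ _ _ hlam (h2 p))).symm
  · intro σ' δ' φ' hd' hg
    rw [sub_le_iff_le_add, ← e]
    refine weak_le hx hy hhx hhy μ ν δ' φ' σ' _ _ hd' (fun p => ?_) (fun p => young _ _ _ hlam)
    exact (fnrm_cs _ _).trans (mul_le_of_le_one_right (fnrm_nonneg _) (hg p))

theorem part3 (hx hy : ℝ) (hhx : 0 < hx) (hhy : 0 < hy)
    (lam : ℝ) (hlam : 0 < lam) (μ ν : Fin Nx × Fin Ny → V) :
    ∃ (σ : Fin Nx × Fin Ny → V × V) (δ φ : Fin Nx × Fin Ny → V),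
      DivC hx hy σ (fun p => μ p - ν p + δ p) ∧
      1 / 2 * n2sqXd hx hy σ + lam / 2 * n2sqX hx hy δ =
        ipX hx hy φ (fun p => ν p - μ p) - 1 / (2 * lam) * n2sqX hx hy φ -
          1 / 2 * n2sqXd hx hy (gradX hx hy φ) ∧
      (∀ (σ' : Fin Nx × Fin Ny → V × V) (δ' φ' : Fin Nx × Fin Ny → V),
        DivC hx hy σ' (fun p => μ p - ν p + δ' p) →
        ipX hx hy φ' (fun p => ν p - μ p) - 1 / (2 * lam) * n2sqX hx hy φ' -
          1 / 2 * n2sqXd hx hy (gradX hx hy φ') ≤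
          1 / 2 * n2sqXd hx hy σ' + lam / 2 * n2sqX hx hy δ') := by
  obtain ⟨σ, δ, φ, hd, h1, h2⟩ := main_lemma hx hy hhx hhy μ ν
    (fun x => 1 / 2 * (fnrm x) ^ 2) (fun y => lam / 2 * ‖y‖ ^ 2)
    (1 + lam⁻¹) (by have := fnrm_cont (V := V); fun_prop) (by fun_prop)
    hfnrm2_conv
    (nsq_conv.smul (by positivity)) (fun x => by positivity) (fun x => by positivity)
    (by positivity)
    (fun x => by
      have := norm_le_fnrm x
      have h3 : 0 ≤ lam⁻¹ * (1 / 2 * (fnrm x) ^ 2 + 1) := by positivity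
      nlinarith [sq_nonneg (fnrm x - 1)])
    (coer_sq lam hlam)
  have e : ∀ (σ : Fin Nx × Fin Ny → V × V) (δ φ : Fin Nx × Fin Ny → V),
      hx * hy * (∑ p, (1 / 2 * fnrm (σ p) ^ 2 + 1 / 2 * fnrm (gradX hx hy φ p) ^ 2)) +
        hx * hy * (∑ p, (lam / 2 * ‖δ p‖ ^ 2 + 1 / (2 * lam) * ‖φ p‖ ^ 2)) =
        1 / 2 * n2sqXd hx hy σ + lam / 2 * n2sqX hx hy δ +
          1 / 2 * n2sqXd hx hy (gradX hx hy φ) + 1 / (2 * lam) * n2sqX hx hy φ := by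
    intro σ δ φ
    simp only [n2sqXd, n2sqX, ← fnrm_sq, ← Finset.mul_sum, Finset.sum_add_distrib]; ring
  have y2 : ∀ s g : V × V, ⟪s.1, g.1⟫ + ⟪s.2, g.2⟫ ≤ 1 / 2 * fnrm s ^ 2 + 1 / 2 * fnrm g ^ 2 := by
    intro s g
    nlinarith [fnrm_cs s g, sq_nonneg (fnrm s - fnrm g)]
  refine ⟨σ, δ, φ, hd, ?_, ?_⟩
  · rw [eq_sub_iff_add_eq, eq_sub_iff_add_eq, ← e]
    refine (strong_eq hx hy μ ν δ φ σ _ _ hd (fun p => ?_)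
      (fun p => subg_sq _ _ _ hlam (h2 p))).symm
    apply le_antisymm (y2 _ _)
    have := h1 p (gradX hx hy φ p)
    simp only [inner_sub_left, real_inner_self_eq_norm_sq] at this
    have h4 := fnrm_sq (gradX hx hy φ p)
    linarith
  · intro σ' δ' φ' hd'
    rw [sub_le_iff_le_add, sub_le_iff_le_add, ← e]
    exact weak_le hx hy hhx hhy μ ν δ' φ' σ' _ _ hd' (fun p => y2 _ _) (fun p => young _ _ _ hlam)

/-- discrete duality formulas for the generalized Beckmann
problems on a Cartesian grid, with attainment of both the primal minima and
the dual maxima: (i) `(p,q) = (1,1)`, (ii) `(p,q) = (1,2)`,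
(iii) `(p,q) = (2,2)`. -/
theorem discrete_duality
    (hNx : 0 < Nx) (hNy : 0 < Ny) (hx hy : ℝ) (hhx : 0 < hx) (hhy : 0 < hy)
    (lam : ℝ) (hlam : 0 < lam) (μ ν : Fin Nx × Fin Ny → V) :
    -- (i) (p,q) = (1,1)
    (∃ (σ : Fin Nx × Fin Ny → V × V) (δ φ : Fin Nx × Fin Ny → V),
      DivC hx hy σ (fun p => μ p - ν p + δ p) ∧
      (∀ p, fnrm (gradX hx hy φ p) ≤ 1) ∧ (∀ p, ‖φ p‖ ≤ lam) ∧
      n1Xd hx hy σ + lam * n1X hx hy δ =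
        ipX hx hy φ (fun p => ν p - μ p) ∧
      (∀ (σ' : Fin Nx × Fin Ny → V × V) (δ' : Fin Nx × Fin Ny → V),
        DivC hx hy σ' (fun p => μ p - ν p + δ' p) →
        n1Xd hx hy σ + lam * n1X hx hy δ ≤
          n1Xd hx hy σ' + lam * n1X hx hy δ') ∧
      (∀ φ' : Fin Nx × Fin Ny → V,
        (∀ p, fnrm (gradX hx hy φ' p) ≤ 1) → (∀ p, ‖φ' p‖ ≤ lam) →
        ipX hx hy φ' (fun p => ν p - μ p) ≤
          ipX hx hy φ (fun p => ν p - μ p))) ∧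
    -- (ii) (p,q) = (1,2)
    (∃ (σ : Fin Nx × Fin Ny → V × V) (δ φ : Fin Nx × Fin Ny → V),
      DivC hx hy σ (fun p => μ p - ν p + δ p) ∧
      (∀ p, fnrm (gradX hx hy φ p) ≤ 1) ∧
      n1Xd hx hy σ + lam / 2 * n2sqX hx hy δ =
        ipX hx hy φ (fun p => ν p - μ p) -
          1 / (2 * lam) * n2sqX hx hy φ ∧
      (∀ (σ' : Fin Nx × Fin Ny → V × V) (δ' : Fin Nx × Fin Ny → V),
        DivC hx hy σ' (fun p => μ p - ν p + δ' p) →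
        n1Xd hx hy σ + lam / 2 * n2sqX hx hy δ ≤
          n1Xd hx hy σ' + lam / 2 * n2sqX hx hy δ') ∧
      (∀ φ' : Fin Nx × Fin Ny → V,
        (∀ p, fnrm (gradX hx hy φ' p) ≤ 1) →
        ipX hx hy φ' (fun p => ν p - μ p) -
            1 / (2 * lam) * n2sqX hx hy φ' ≤
          ipX hx hy φ (fun p => ν p - μ p) -
            1 / (2 * lam) * n2sqX hx hy φ)) ∧
    -- (iii) (p,q) = (2,2)
    (∃ (σ : Fin Nx × Fin Ny → V × V) (δ φ : Fin Nx × Fin Ny → V),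
      DivC hx hy σ (fun p => μ p - ν p + δ p) ∧
      1 / 2 * n2sqXd hx hy σ + lam / 2 * n2sqX hx hy δ =
        ipX hx hy φ (fun p => ν p - μ p) -
          1 / (2 * lam) * n2sqX hx hy φ -
          1 / 2 * n2sqXd hx hy (gradX hx hy φ) ∧
      (∀ (σ' : Fin Nx × Fin Ny → V × V) (δ' : Fin Nx × Fin Ny → V),
        DivC hx hy σ' (fun p => μ p - ν p + δ' p) →
        1 / 2 * n2sqXd hx hy σ + lam / 2 * n2sqX hx hy δ ≤
          1 / 2 * n2sqXd hx hy σ' + lam / 2 * n2sqX hx hy δ') ∧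
      (∀ φ' : Fin Nx × Fin Ny → V,
        ipX hx hy φ' (fun p => ν p - μ p) -
            1 / (2 * lam) * n2sqX hx hy φ' -
            1 / 2 * n2sqXd hx hy (gradX hx hy φ') ≤
          ipX hx hy φ (fun p => ν p - μ p) -
            1 / (2 * lam) * n2sqX hx hy φ -
            1 / 2 * n2sqXd hx hy (gradX hx hy φ))) := by
  refine ⟨?_, ?_, ?_⟩
  · obtain ⟨σ, δ, φ, hd, h1, h2, h3, h4⟩ := part1 hx hy hhx hhy lam hlam μ ν
    refine ⟨σ, δ, φ, hd, h1, h2, h3, fun σ' δ' hd' => ?_, fun φ' h1' h2' => ?_⟩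
    · rw [h3]; exact h4 σ' δ' φ hd' h1 h2
    · rw [← h3]; exact h4 σ δ φ' hd h1' h2'
  · obtain ⟨σ, δ, φ, hd, h1, h3, h4⟩ := part2 hx hy hhx hhy lam hlam μ ν
    refine ⟨σ, δ, φ, hd, h1, h3, fun σ' δ' hd' => ?_, fun φ' h1' => ?_⟩
    · rw [h3]; exact h4 σ' δ' φ hd' h1
    · rw [← h3]; exact h4 σ δ φ' hd h1'
  · obtain ⟨σ, δ, φ, hd, h3, h4⟩ := part3 hx hy hhx hhy lam hlam μ ν
    refine ⟨σ, δ, φ, hd, h3, fun σ' δ' hd' => ?_, fun φ' => ?_⟩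
    · rw [h3]; exact h4 σ' δ' φ hd'
    · rw [← h3]; exact h4 σ δ φ' hd
end
end
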